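/- arXiv:math/0609799 — 3 statements merged into one kernel-verified Lean document; each statement's English description precedes it below -/
import Mathlib

section
/- Assume condition (9). Then there exists a K-linear combination L of multiple zeta values of depth at most p − 1 such that S(P) = L + Σ_{s_1, …, s_p} (Σ_{j_1=0}^{n_1} ⋯ Σ_{j_p=0}^{n_p} C[∅, ∅, (s_1, …, s_p), (j_1, …, j_p)]) · ζ(s_1, …, s_p), where the outer sum runs over all tuples (s_1, …, s_p) with s_1 ≥ 2 and 1 ≤ s_i ≤ A_i for every i. That is, the coefficient of each depth-p multiple zeta value ζ(s_1, …, s_p) in the linear combination representing S(P) equals the sum Σ_{j_1=0}^{n_1} ⋯ Σ_{j_p=0}^{n_p} C[∅, ∅, (s_1, …, s_p), (j_1, …, j_p)] of partial fraction coefficients. -/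
/-- The multiple zeta value `ζ(s₁, …, s_q)`, defined as a sum over strictly
decreasing tuples `k₁ > k₂ > … > k_q ≥ 1`.  For the empty list it equals `1`. -/
noncomputable def mzv (s : List ℕ) : ℝ :=
  ∑' k : {k : Fin s.length → ℕ // StrictAnti k ∧ ∀ i, 1 ≤ k i},
    ∏ i : Fin s.length, ((k.1 i : ℝ) ^ s.get i)⁻¹

/-- The rational function `P(k₁,…,k_p) / ∏ᵢ ((kᵢ+rᵢ)_{nᵢ+1})^{Aᵢ}`. -/
noncomputable def Rfun (p : ℕ) (K : Subfield ℂ) (A n r : ℕ → ℕ)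
    (P : MvPolynomial (Fin p) K) (k : Fin p → ℂ) : ℂ :=
  MvPolynomial.eval₂ K.subtype k P /
    ∏ i : Fin p, ((ascPochhammer ℂ (n i.1 + 1)).eval (k i + (r i.1 : ℂ))) ^ A i.1

/-- An elementary term of a partial fraction expansion in the variables
`k₁, …, k_p` : in each variable it is either a monomial `kᵢ^fᵢ` (for `i ∈ I`,
encoded by `Sum.inl fᵢ`) or a polar factor `1/(kᵢ+rᵢ+jᵢ)^{sᵢ}` (for `i ∉ I`,
encoded by `Sum.inr (sᵢ, jᵢ)`). -/
noncomputable def pfTerm (p : ℕ) (r : ℕ → ℕ) (w : Fin p → ℕ ⊕ ℕ × ℕ)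
    (k : Fin p → ℂ) : ℂ :=
  ∏ i : Fin p,
    Sum.elim (fun f : ℕ => k i ^ f)
      (fun sj : ℕ × ℕ => ((k i + (r i.1 : ℂ) + (sj.2 : ℂ)) ^ sj.1)⁻¹) (w i)

namespace NestedSum

open Finset Filter Topology

/-- Weighted partial sums: `op f u k = ∑_{l ≤ k} f l * u l`. -/
def op (f u : ℕ → ℂ) : ℕ → ℂ := fun k => ∑ l ∈ range (k + 1), f l * u l

/-- The truncated nested sum `∑_{k ≥ l₁ ≥ l₂ ≥ … ≥ 0} f₁(l₁) f₂(l₂) ⋯`. -/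
def nested (fs : List (ℕ → ℂ)) : ℕ → ℂ := fs.foldr op 1

/-- The shift `l ↦ g (l + 1)`. -/
def shift (g : ℕ → ℂ) : ℕ → ℂ := fun l => g (l + 1)

/-- The forward difference operator. -/
def fdiff (K : Subfield ℂ) : (ℕ → ℂ) →ₗ[K] (ℕ → ℂ) where
  toFun g := fun l => g (l + 1) - g l
  map_add' f g := by funext l; simp only [Pi.add_apply]; ring
  map_smul' c g := by
    funext l
    simp only [Pi.smul_apply, RingHom.id_apply, smul_sub]

lemma fdiff_apply (K : Subfield ℂ) (g : ℕ → ℂ) (l : ℕ) : fdiff K g l = g (l + 1) - g l := rfl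

lemma op_succ (f u : ℕ → ℂ) (k : ℕ) : op f u (k + 1) = op f u k + f (k + 1) * u (k + 1) := by
  simp [op, sum_range_succ]

lemma op_zero_apply (f u : ℕ → ℂ) : op f u 0 = f 0 * u 0 := by simp [op]

lemma op_add_left (f g u : ℕ → ℂ) : op (f + g) u = op f u + op g u := by
  funext k; simp [op, add_mul, sum_add_distrib]

lemma op_add_right (f u v : ℕ → ℂ) : op f (u + v) = op f u + op f v := by
  funext k; simp [op, mul_add, sum_add_distrib]

lemma op_sub_right (f u v : ℕ → ℂ) : op f (u - v) = op f u - op f v := by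
  funext k; simp [op, mul_sub, sum_sub_distrib]

lemma op_smul_right {K : Subfield ℂ} (c : K) (f u : ℕ → ℂ) : op f (c • u) = c • op f u := by
  funext k; simp [op, smul_sum]

/-- Summation by parts. -/
lemma op_fdiff_op (K : Subfield ℂ) (g h u : ℕ → ℂ) :
    op (fdiff K g) (op h u) = shift g * op h u - op (h * g) u := by
  funext k
  simp only [Pi.sub_apply, Pi.mul_apply]
  induction k with
  | zero => simp only [op_zero_apply, fdiff_apply, shift, Pi.mul_apply]; ring
  | succ k ih =>
    rw [op_succ (fdiff K g), ih, op_succ h, op_succ (h * g)]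
    simp only [fdiff_apply, shift, Pi.mul_apply]; ring

lemma op_fdiff_one (K : Subfield ℂ) (g : ℕ → ℂ) : op (fdiff K g) 1 = fun k => shift g k - g 0 := by
  funext k
  induction k with
  | zero => simp [op_zero_apply, fdiff_apply, shift]
  | succ k ih => rw [op_succ, ih]; simp [fdiff_apply, shift]

lemma op_mul (f g u : ℕ → ℂ) : op f (g * u) = op (f * g) u := by
  funext k; simp [op, mul_assoc]

lemma nested_nil : nested [] = 1 := rfl

lemma nested_cons (f : ℕ → ℂ) (fs) : nested (f :: fs) = op f (nested fs) := rfl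

lemma nested_append (pre suf) : nested (pre ++ suf) = pre.foldr op (nested suf) := by
  simp [nested]

lemma foldr_op_sub (pre : List (ℕ → ℂ)) (u v : ℕ → ℂ) :
    pre.foldr op (u - v) = pre.foldr op u - pre.foldr op v := by
  induction pre with
  | nil => rfl
  | cons f pre ih => simp [ih, op_sub_right]

lemma foldr_op_smul {K : Subfield ℂ} (c : K) (pre : List (ℕ → ℂ)) (u : ℕ → ℂ) :
    pre.foldr op (c • u) = c • pre.foldr op u := by
  induction pre with
  | nil => rfl
  | cons f pre ih => simp only [List.foldr_cons, ih, op_smul_right]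

lemma nested_append_add_cons (pre : List (ℕ → ℂ)) (f g : ℕ → ℂ) (suf) :
    nested (pre ++ (f + g) :: suf) = nested (pre ++ f :: suf) + nested (pre ++ g :: suf) := by
  induction pre with
  | nil => simp [nested_cons, op_add_left]
  | cons f pre ih => simp only [List.cons_append, nested_cons, ih, op_add_right]

/-! ### The classes of rational functions -/

/-- The function `l ↦ (l+1)^i / ∏_{j ∈ m} (l+1+r+j)`. -/
noncomputable def gen (r i : ℕ) (m : Multiset ℕ) : ℕ → ℂ :=
  fun l => ((l : ℂ) + 1) ^ i * ((m.map fun j : ℕ => (l : ℂ) + 1 + r + j).prod)⁻¹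

/-- The span of the functions `gen 0 i m` of degree at most `e - 1`. -/
noncomputable def Cls (K : Subfield ℂ) (e : ℤ) : Submodule K (ℕ → ℂ) :=
  Submodule.span K {f | ∃ (i : ℕ) (m : Multiset ℕ), (i : ℤ) + 1 ≤ m.card + e ∧ f = gen 0 i m}

variable {K : Subfield ℂ}

lemma gen_eq_gen_zero (r i : ℕ) (m : Multiset ℕ) : gen r i m = gen 0 i (m.map (r + ·)) := by
  funext l
  simp [gen, add_assoc]

lemma gen_mem_Cls {e : ℤ} (r i : ℕ) (m : Multiset ℕ) (h : (i : ℤ) + 1 ≤ m.card + e) :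
    gen r i m ∈ Cls K e := by
  rw [gen_eq_gen_zero]
  exact Submodule.subset_span ⟨i, m.map (r + ·), by simpa using h, rfl⟩

lemma Cls_mono {e e' : ℤ} (h : e ≤ e') : Cls K e ≤ Cls K e' := by
  refine Submodule.span_mono ?_
  rintro f ⟨i, m, him, rfl⟩
  exact ⟨i, m, by omega, rfl⟩

lemma gen_mul_gen (r i i' : ℕ) (m m' : Multiset ℕ) :
    gen r i m * gen r i' m' = gen r (i + i') (m + m') := by
  funext l
  simp only [gen, Pi.mul_apply, Multiset.map_add, Multiset.prod_add, pow_add, mul_inv]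
  ring

lemma mul_mem_Cls {e e' : ℤ} {f g : ℕ → ℂ} (hf : f ∈ Cls K e) (hg : g ∈ Cls K e') :
    f * g ∈ Cls K (e + e' - 1) := by
  have h := Submodule.mul_mem_mul hf hg
  rw [Cls, Cls, Submodule.span_mul_span] at h
  refine Submodule.span_le.2 ?_ h
  rintro _ ⟨_, ⟨i, m, h1, rfl⟩, _, ⟨i', m', h2, rfl⟩, rfl⟩
  simp only [gen_mul_gen]
  exact gen_mem_Cls _ _ _ (by rw [Multiset.card_add]; push_cast; omega)

lemma shift_mem_Cls {e : ℤ} {f : ℕ → ℂ} (hf : f ∈ Cls K e) : shift f ∈ Cls K e := by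
  induction hf using Submodule.span_induction with
  | mem f hf =>
    obtain ⟨i, m, him, rfl⟩ := hf
    have : shift (gen 0 i m) = ∑ t ∈ range (i + 1), (i.choose t) • gen 1 t m := by
      funext l
      simp only [shift, gen, Nat.cast_add, Nat.cast_one, Finset.sum_apply, nsmul_eq_mul,
        Pi.mul_apply, Pi.natCast_apply, Nat.cast_zero, add_zero]
      rw [add_pow ((l : ℂ) + 1) 1 i, Finset.sum_mul]
      refine Finset.sum_congr rfl fun t _ => ?_
      simp only [one_pow, mul_one]
      ring
    rw [this]
    refine Submodule.sum_mem _ fun t ht => Submodule.smul_of_tower_mem _ _ (gen_mem_Cls _ _ _ ?_)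
    have := mem_range.1 ht
    omega
  | zero => exact Submodule.zero_mem _
  | add f g _ _ hf hg => exact Submodule.add_mem _ hf hg
  | smul c f _ hf => exact Submodule.smul_mem _ c hf

lemma exists_apply_zero {e : ℤ} {f : ℕ → ℂ} (hf : f ∈ Cls K e) : ∃ c : K, f 0 = c := by
  induction hf using Submodule.span_induction with
  | mem f hf =>
    obtain ⟨i, m, him, rfl⟩ := hf
    refine ⟨((m.map fun j : ℕ => (1 : K) + j).prod)⁻¹, ?_⟩
    simp only [gen, Nat.cast_zero, zero_add, one_pow, one_mul, add_zero]
    rw [← Subfield.coe_subtype, map_inv₀, map_multiset_prod, Multiset.map_map]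
    simp
  | zero => exact ⟨0, by simp⟩
  | add f g _ _ hf hg =>
    obtain ⟨a, ha⟩ := hf
    obtain ⟨b, hb⟩ := hg
    exact ⟨a + b, by simp [ha, hb]⟩
  | smul c f _ hf =>
    obtain ⟨a, ha⟩ := hf
    exact ⟨c * a, by simp [ha, Subfield.smul_def]⟩

lemma norm_gen_le (r i : ℕ) (m : Multiset ℕ) (l : ℕ) :
    ‖gen r i m l‖ ≤ ((l : ℝ) + 1) ^ ((i : ℤ) - m.card) := by
  have hl : (0 : ℝ) < (l : ℝ) + 1 := by positivity
  have h : ((l : ℝ) + 1) ^ m.card ≤ ‖(m.map fun j : ℕ => (l : ℂ) + 1 + r + j).prod‖ := by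
    induction m using Multiset.induction with
    | empty => simp
    | cons a m ih =>
      rw [Multiset.map_cons, Multiset.prod_cons, norm_mul, Multiset.card_cons, pow_succ']
      refine mul_le_mul ?_ ih (by positivity) (norm_nonneg _)
      have : ‖(l : ℂ) + 1 + r + a‖ = (l : ℝ) + 1 + r + a := by
        exact_mod_cast Complex.norm_natCast (l + 1 + r + a)
      rw [this]
      have : (0 : ℝ) ≤ r + a := by positivity
      linarith
  have hn : ‖(l : ℂ) + 1‖ = (l : ℝ) + 1 := by exact_mod_cast Complex.norm_natCast (l + 1)
  rw [gen, norm_mul, norm_inv, norm_pow, hn, zpow_sub₀ hl.ne', zpow_natCast, zpow_natCast,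
    div_eq_mul_inv]
  gcongr

lemma exists_norm_le {e : ℤ} {f : ℕ → ℂ} (hf : f ∈ Cls K e) :
    ∃ C : ℝ, 0 ≤ C ∧ ∀ l : ℕ, ‖f l‖ ≤ C * ((l : ℝ) + 1) ^ (e - 1) := by
  induction hf using Submodule.span_induction with
  | mem f hf =>
    obtain ⟨i, m, him, rfl⟩ := hf
    refine ⟨1, zero_le_one, fun l => ?_⟩
    rw [one_mul]
    refine (norm_gen_le _ _ _ _).trans (zpow_le_zpow_right₀ ?_ (by omega))
    simp
  | zero => exact ⟨0, le_rfl, by simp⟩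
  | add f g _ _ hf hg =>
    obtain ⟨a, ha, hfa⟩ := hf
    obtain ⟨b, hb, hgb⟩ := hg
    refine ⟨a + b, by positivity, fun l => (norm_add_le _ _).trans ?_⟩
    rw [add_mul]
    exact add_le_add (hfa l) (hgb l)
  | smul c f _ hf =>
    obtain ⟨a, ha, hfa⟩ := hf
    refine ⟨‖(c : ℂ)‖ * a, by positivity, fun l => ?_⟩
    rw [Pi.smul_apply, Subfield.smul_def, smul_eq_mul, norm_mul, mul_assoc]
    gcongr
    exact hfa l

/-! ### Growth of nested sums -/

lemma sum_inv_sqrt_le (k : ℕ) :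
    ∑ l ∈ range (k + 1), (√((l : ℝ) + 1))⁻¹ ≤ 2 * √((k : ℝ) + 1) := by
  induction k with
  | zero => simp
  | succ k ih =>
    rw [sum_range_succ]
    refine (add_le_add_left ih _).trans ?_
    have h1 : 0 < √((k : ℝ) + 1) := by positivity
    have h2 : √((k : ℝ) + 1) ≤ √(((k + 1 : ℕ) : ℝ) + 1) := Real.sqrt_le_sqrt (by push_cast; linarith)
    have h3 : √((k : ℝ) + 1) ^ 2 = (k : ℝ) + 1 := Real.sq_sqrt (by positivity)
    have h4 : √(((k + 1 : ℕ) : ℝ) + 1) ^ 2 = ((k + 1 : ℕ) : ℝ) + 1 := Real.sq_sqrt (by positivity)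
    set a := √((k : ℝ) + 1)
    set b := √(((k + 1 : ℕ) : ℝ) + 1)
    have hb : 0 < b := h1.trans_le h2
    push_cast at h4
    have : b⁻¹ ≤ 2 * (b - a) := by
      rw [inv_le_iff_one_le_mul₀ hb]
      nlinarith
    linarith

lemma exists_norm_nested_le (fs : List (ℕ → ℂ)) (h : ∀ f ∈ fs, f ∈ Cls K 0) :
    ∃ C : ℝ, 0 ≤ C ∧ ∀ k : ℕ, ‖nested fs k‖ ≤ C * √((k : ℝ) + 1) := by
  induction fs with
  | nil =>
    refine ⟨1, zero_le_one, fun k => ?_⟩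
    simp [nested_nil, Real.one_le_sqrt]
  | cons f fs ih =>
    obtain ⟨C, hC, hu⟩ := ih fun g hg => h g (List.mem_cons_of_mem _ hg)
    obtain ⟨D, hD, hf⟩ := exists_norm_le (h f List.mem_cons_self)
    refine ⟨2 * D * C, by positivity, fun k => ?_⟩
    rw [nested_cons, op]
    calc ‖∑ l ∈ range (k + 1), f l * nested fs l‖
        ≤ ∑ l ∈ range (k + 1), D * C * (√((l : ℝ) + 1))⁻¹ := by
          refine norm_sum_le_of_le _ fun l _ => ?_
          rw [norm_mul]
          refine (mul_le_mul (hf l) (hu l) (norm_nonneg _) (by positivity)).trans (le_of_eq ?_)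
          have h3 : √((l : ℝ) + 1) * √((l : ℝ) + 1) = (l : ℝ) + 1 :=
            Real.mul_self_sqrt (by positivity)
          have h4 : √((l : ℝ) + 1) ≠ 0 := by positivity
          have h5 : (l : ℝ) + 1 ≠ 0 := by positivity
          rw [zero_sub, zpow_neg_one]
          field_simp
          rw [sq, h3]
          ring
      _ = D * C * ∑ l ∈ range (k + 1), (√((l : ℝ) + 1))⁻¹ := by rw [mul_sum]
      _ ≤ D * C * (2 * √((k : ℝ) + 1)) := by gcongr; exact sum_inv_sqrt_le k
      _ = 2 * D * C * √((k : ℝ) + 1) := by ring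

lemma tendsto_shift_mul_nested {g : ℕ → ℂ} (hg : g ∈ Cls K 0) (fs : List (ℕ → ℂ))
    (h : ∀ f ∈ fs, f ∈ Cls K 0) : Tendsto (shift g * nested fs) atTop (𝓝 0) := by
  obtain ⟨C, hC, hu⟩ := exists_norm_nested_le fs h
  obtain ⟨D, hD, hf⟩ := exists_norm_le (shift_mem_Cls hg)
  have hlim : Tendsto (fun k : ℕ => D * C * (√((k : ℝ) + 1))⁻¹) atTop (𝓝 (D * C * 0)) := by
    refine Tendsto.const_mul _ (tendsto_inv_atTop_zero.comp (Real.tendsto_sqrt_atTop.comp ?_))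
    exact tendsto_atTop_add_const_right _ _ tendsto_natCast_atTop_atTop
  rw [mul_zero] at hlim
  refine squeeze_zero_norm (fun k => ?_) hlim
  rw [Pi.mul_apply, norm_mul]
  refine (mul_le_mul (hf k) (hu k) (norm_nonneg _) (by positivity)).trans (le_of_eq ?_)
  have h3 : √((k : ℝ) + 1) * √((k : ℝ) + 1) = (k : ℝ) + 1 := Real.mul_self_sqrt (by positivity)
  have h4 : √((k : ℝ) + 1) ≠ 0 := by positivity
  have h5 : (k : ℝ) + 1 ≠ 0 := by positivity
  rw [zero_sub, zpow_neg_one]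
  field_simp
  rw [sq, h3]
  ring

/-- The `K`-span of the convergent multiple zeta values of depth at most `q`. -/
noncomputable def mzvSpan (K : Subfield ℂ) (q : ℕ) : Submodule K ℂ :=
  Submodule.span K ((fun s : List ℕ => (mzv s : ℂ)) ''
    {s | s.length ≤ q ∧ (∀ a ∈ s, 1 ≤ a) ∧ (s ≠ [] → 2 ≤ s.headI)})

/-- The sequences converging to a limit in `Z`. -/
def Conv (Z : Submodule K ℂ) : Submodule K (ℕ → ℂ) where
  carrier := {u | ∃ v ∈ Z, Tendsto u atTop (𝓝 v)}
  add_mem' := by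
    rintro u v ⟨x, hx, hu⟩ ⟨y, hy, hv⟩
    exact ⟨x + y, Z.add_mem hx hy, hu.add hv⟩
  zero_mem' := ⟨0, Z.zero_mem, tendsto_const_nhds⟩
  smul_mem' := by
    rintro c u ⟨x, hx, hu⟩
    exact ⟨c • x, Z.smul_mem c hx, hu.const_mul (c : ℂ)⟩

lemma mem_Conv {Z : Submodule K ℂ} {u : ℕ → ℂ} :
    u ∈ Conv Z ↔ ∃ v ∈ Z, Tendsto u atTop (𝓝 v) := Iff.rfl

lemma Conv_mono {Z Z' : Submodule K ℂ} (h : Z ≤ Z') : Conv Z ≤ Conv Z' :=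
  fun _ ⟨v, hv, hu⟩ => ⟨v, h hv, hu⟩

lemma mzvSpan_mono {q q' : ℕ} (h : q ≤ q') : mzvSpan K q ≤ mzvSpan K q' :=
  Submodule.span_mono (Set.image_mono fun _ hs => ⟨hs.1.trans h, hs.2⟩)

lemma mzv_nil : mzv [] = 1 := by
  have : Unique {k : Fin ([] : List ℕ).length → ℕ // StrictAnti k ∧ ∀ i, 1 ≤ k i} :=
    { default := ⟨fun i => i.elim0, fun i => i.elim0, fun i => i.elim0⟩
      uniq := fun _ => Subtype.ext (funext fun i => i.elim0) }
  rw [mzv, tsum_fintype, Fintype.sum_unique]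
  exact Fin.prod_univ_zero _

lemma coe_mem_mzvSpan (q : ℕ) (c : K) : (c : ℂ) ∈ mzvSpan K q := by
  have h : (mzv [] : ℂ) ∈ mzvSpan K q := Submodule.subset_span ⟨[], by simp, rfl⟩
  rw [mzv_nil] at h
  simpa [Subfield.smul_def] using Submodule.smul_mem _ c h

lemma const_mem_Conv (q : ℕ) (c : K) : (fun _ => (c : ℂ)) ∈ Conv (mzvSpan K q) :=
  ⟨c, coe_mem_mzvSpan q c, tendsto_const_nhds⟩

/-- All partial sums of `es`, started at `c`, are at most `-1`. -/
def PartialSumsNeg : ℤ → List ℤ → Prop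
  | _, [] => True
  | c, e :: es => c + e ≤ -1 ∧ PartialSumsNeg (c + e) es

lemma partialSumsNeg_nil (c : ℤ) : PartialSumsNeg c [] := trivial

lemma partialSumsNeg_cons {c e : ℤ} {es : List ℤ} :
    PartialSumsNeg c (e :: es) ↔ c + e ≤ -1 ∧ PartialSumsNeg (c + e) es := Iff.rfl

lemma partialSumsNeg_append {c : ℤ} {as bs : List ℤ} :
    PartialSumsNeg c (as ++ bs) ↔ PartialSumsNeg c as ∧ PartialSumsNeg (c + as.sum) bs := by
  induction as generalizing c with
  | nil => simp [partialSumsNeg_nil]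
  | cons a as ih => simp [partialSumsNeg_cons, ih, and_assoc, add_assoc]

lemma partialSumsNeg_of_nonpos {c : ℤ} (hc : c ≤ -1) {es : List ℤ} (h : ∀ e ∈ es, e ≤ 0) :
    PartialSumsNeg c es := by
  induction es generalizing c with
  | nil => trivial
  | cons a as ih =>
    have ha := h a List.mem_cons_self
    exact ⟨by omega, ih (by omega) fun e he => h e (List.mem_cons_of_mem _ he)⟩

/-- Nested sums of depth at most `q` satisfying the convergence condition converge to elements of
`mzvSpan K q`. -/
def LimitsInSpan (K : Subfield ℂ) (q : ℕ) : Prop :=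
  ∀ L : List (ℤ × (ℕ → ℂ)), L.length ≤ q → (∀ x ∈ L, x.2 ∈ Cls K x.1) →
    PartialSumsNeg 0 (L.map Prod.fst) → nested (L.map Prod.snd) ∈ Conv (mzvSpan K q)

lemma nested_inner_fdiff_mem {q : ℕ} (hq : LimitsInSpan K q) (pre suf : List (ℤ × (ℕ → ℂ)))
    (hne : pre ≠ []) (hlen : pre.length + suf.length ≤ q) (hpre : ∀ x ∈ pre, x.2 ∈ Cls K x.1)
    (hsuf : ∀ x ∈ suf, x.2 ∈ Cls K x.1) {e : ℤ} {g : ℕ → ℂ} (hg : g ∈ Cls K (e + 1))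
    (hneg : PartialSumsNeg 0 (pre.map Prod.fst ++ e :: suf.map Prod.fst)) :
    nested (pre.map Prod.snd ++ fdiff K g :: suf.map Prod.snd) ∈ Conv (mzvSpan K q) := by
  obtain ⟨pre, x, rfl⟩ := List.eq_nil_or_concat pre |>.resolve_left hne
  simp only [List.concat_eq_append, List.mem_append, List.mem_singleton, List.length_append,
    List.length_singleton] at hpre hlen
  simp only [List.concat_eq_append, List.map_append, List.map_cons, List.map_nil,
    List.append_assoc, List.singleton_append, partialSumsNeg_append, partialSumsNeg_cons] at hneg
  have hx : x.2 ∈ Cls K x.1 := hpre x (Or.inr rfl)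
  have hxg : x.2 * shift g ∈ Cls K (x.1 + e) := by
    have := mul_mem_Cls hx (shift_mem_Cls hg)
    rwa [show x.1 + (e + 1) - 1 = x.1 + e by ring] at this
  cases suf with
  | nil =>
    obtain ⟨c, hc⟩ := exists_apply_zero hg
    have h1 := hq (pre ++ [(x.1 + e, x.2 * shift g)]) (by simpa using hlen) (by
      intro y hy
      rcases List.mem_append.1 hy with hy | hy
      · exact hpre y (Or.inl hy)
      · rw [List.mem_singleton.1 hy]; exact hxg) (by
      simp only [List.map_append, List.map_cons, List.map_nil, partialSumsNeg_append,
        partialSumsNeg_cons, partialSumsNeg_nil, and_true]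
      exact ⟨hneg.1, by linarith [hneg.2.2.1]⟩)
    have h2 := hq (pre ++ [x]) (by simpa using hlen) (by
      intro y hy
      rcases List.mem_append.1 hy with hy | hy
      · exact hpre y (Or.inl hy)
      · rw [List.mem_singleton.1 hy]; exact hx) (by
      simp only [List.map_append, List.map_cons, List.map_nil, partialSumsNeg_append,
        partialSumsNeg_cons, partialSumsNeg_nil, and_true]
      exact ⟨hneg.1, hneg.2.1⟩)
    convert Submodule.sub_mem _ h1 (Submodule.smul_mem _ c h2) using 1
    simp only [List.concat_eq_append, List.map_append, List.map_cons, List.map_nil,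
      List.append_assoc, List.singleton_append, nested_append, nested_cons,
      nested_nil, op_fdiff_one, ← foldr_op_smul, ← foldr_op_sub, ← op_smul_right]
    rw [← op_mul, ← op_sub_right]
    congr 2
    funext k
    simp [hc, Subfield.smul_def]
  | cons y suf =>
    have hy : y.2 ∈ Cls K y.1 := hsuf y List.mem_cons_self
    have hyg : y.2 * g ∈ Cls K (y.1 + e) := by
      have := mul_mem_Cls hy hg
      rwa [show y.1 + (e + 1) - 1 = y.1 + e by ring] at this
    simp only [List.length_cons, List.map_cons, partialSumsNeg_cons] at hlen hneg
    have hsuf' := fun z hz => hsuf z (List.mem_cons_of_mem y hz)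
    have h1 := hq (pre ++ (x.1 + e, x.2 * shift g) :: y :: suf) (by simp; omega) (by
      intro z hz
      simp only [List.mem_append, List.mem_cons] at hz
      rcases hz with hz | rfl | rfl | hz
      · exact hpre z (Or.inl hz)
      · exact hxg
      · exact hy
      · exact hsuf' z hz) (by
      simp only [List.map_append, List.map_cons, partialSumsNeg_append, partialSumsNeg_cons,
        ← add_assoc]
      exact ⟨hneg.1, hneg.2.2⟩)
    have h2 := hq (pre ++ x :: (y.1 + e, y.2 * g) :: suf) (by simp; omega) (by
      intro z hz
      simp only [List.mem_append, List.mem_cons] at hz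
      rcases hz with hz | rfl | rfl | hz
      · exact hpre z (Or.inl hz)
      · exact hx
      · exact hyg
      · exact hsuf' z hz) (by
      simp only [List.map_append, List.map_cons, partialSumsNeg_append, partialSumsNeg_cons]
      refine ⟨hneg.1, hneg.2.1, ?_⟩
      rw [add_comm y.1 e, ← add_assoc]
      exact hneg.2.2.2)
    convert Submodule.sub_mem _ h1 h2 using 1
    simp only [List.concat_eq_append, List.map_append, List.map_cons, List.map_nil,
      List.append_assoc, List.singleton_append, nested_append, nested_cons,
      op_fdiff_op, ← foldr_op_sub]
    rw [← op_mul x.2, ← op_sub_right]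

lemma nested_fdiff_cons_mem {q : ℕ} (hq : LimitsInSpan K q) (suf : List (ℕ → ℂ))
    (hlen : suf.length ≤ q) (hsuf : ∀ f ∈ suf, f ∈ Cls K 0) {g : ℕ → ℂ} (hg : g ∈ Cls K 0) :
    nested (fdiff K g :: suf) ∈ Conv (mzvSpan K q) := by
  have hlim : shift g * nested suf ∈ Conv (mzvSpan K q) :=
    ⟨0, Submodule.zero_mem _, tendsto_shift_mul_nested hg suf hsuf⟩
  cases suf with
  | nil =>
    obtain ⟨c, hc⟩ := exists_apply_zero hg
    convert Submodule.sub_mem _ hlim (const_mem_Conv q c) using 1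
    rw [nested_cons, nested_nil, op_fdiff_one]
    funext k
    simp [hc]
  | cons h suf =>
    have hh : h * g ∈ Cls K (-1) := by
      have := mul_mem_Cls (hsuf h List.mem_cons_self) hg
      rwa [show (0 : ℤ) + 0 - 1 = -1 by ring] at this
    have h2 := hq ((-1, h * g) :: suf.map fun f => (0, f)) (by simpa using hlen) (by
      intro z hz
      simp only [List.mem_cons, List.mem_map] at hz
      rcases hz with rfl | ⟨f, hf, rfl⟩
      · exact hh
      · exact hsuf f (List.mem_cons_of_mem _ hf)) (by
      rw [List.map_cons, partialSumsNeg_cons]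
      refine ⟨by simp, partialSumsNeg_of_nonpos (by simp) ?_⟩
      intro e he
      simp only [List.map_map, List.mem_map, Function.comp_apply] at he
      obtain ⟨_, _, rfl⟩ := he
      exact le_rfl)
    convert Submodule.sub_mem _ hlim h2 using 1
    simp only [nested_cons, op_fdiff_op, List.map_cons, List.map_map, Function.comp_def,
      List.map_id']

lemma nested_congr_tail {q : ℕ} (hq : LimitsInSpan K q) {ι : Type*} (E : ι → ℤ)
    (F H G : ι → ℕ → ℂ) (hF : ∀ i, F i ∈ Cls K (E i)) (hH : ∀ i, H i ∈ Cls K (E i))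
    (hG : ∀ i, G i ∈ Cls K (E i + 1)) (hFH : ∀ i, F i = H i + fdiff K (G i)) (l : List ι)
    (pre : List (ℤ × (ℕ → ℂ))) (hne : pre ≠ []) (hlen : pre.length + l.length ≤ q + 1)
    (hpre : ∀ x ∈ pre, x.2 ∈ Cls K x.1)
    (hneg : PartialSumsNeg 0 (pre.map Prod.fst ++ l.map E)) :
    nested (pre.map Prod.snd ++ l.map F) - nested (pre.map Prod.snd ++ l.map H)
      ∈ Conv (mzvSpan K q) := by
  induction l generalizing pre with
  | nil => simp
  | cons i l ih =>
    have h1 := nested_inner_fdiff_mem hq pre (l.map fun i => (E i, F i)) hne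
      (by simp at hlen ⊢; omega) hpre (by
        intro x hx
        obtain ⟨i, _, rfl⟩ := List.mem_map.1 hx
        exact hF i) (hG i) (by simpa [Function.comp_def] using hneg)
    have h2 := ih (pre ++ [(E i, H i)]) (by simp) (by simp at hlen ⊢; omega) (by
      intro x hx
      rcases List.mem_append.1 hx with hx | hx
      · exact hpre x hx
      · rw [List.mem_singleton.1 hx]; exact hH i) (by simpa using hneg)
    convert Submodule.add_mem _ h1 h2 using 1
    simp only [List.map_cons, hFH i, nested_append_add_cons, List.map_map, Function.comp_def,
      List.map_append, List.map_nil, List.append_assoc, List.singleton_append]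
    abel

/-! ### Differences -/

lemma pow_mem_map_fdiff (i : ℕ) :
    (fun l : ℕ => ((l : ℂ) + 1) ^ i) ∈ (Cls K (i + 2)).map (fdiff K) := by
  induction i using Nat.strong_induction_on with
  | _ i ih =>
    have h1 : fdiff K (gen 0 (i + 1) 0) ∈ (Cls K (i + 2)).map (fdiff K) :=
      Submodule.mem_map_of_mem (gen_mem_Cls _ _ _ (by simp))
    have h2 : ∑ t ∈ range i, ((i + 1).choose t) • (fun l : ℕ => ((l : ℂ) + 1) ^ t) ∈
        (Cls K (i + 2)).map (fdiff K) := by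
      refine Submodule.sum_mem _ fun t ht => Submodule.smul_of_tower_mem _ _ ?_
      have hti := mem_range.1 ht
      exact Submodule.map_mono (Cls_mono (by omega)) (ih t hti)
    have h3 := Submodule.smul_mem _ ((i + 1 : K)⁻¹) (Submodule.sub_mem _ h1 h2)
    convert h3 using 1
    funext l
    have hi : ((i : ℂ) + 1) ≠ 0 := by exact_mod_cast Nat.succ_ne_zero i
    have hb := add_pow ((l : ℂ) + 1) 1 (i + 1)
    rw [sum_range_succ, sum_range_succ] at hb
    simp only [one_pow, mul_one, Nat.choose_self, Nat.cast_one, Nat.choose_succ_self_right,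
      Nat.cast_add] at hb
    simp only [Subfield.smul_def, smul_eq_mul, Pi.smul_apply, Pi.sub_apply, fdiff_apply, gen,
      Finset.sum_apply, Multiset.map_zero, Multiset.prod_zero, inv_one, mul_one, nsmul_eq_mul,
      Nat.cast_add, Nat.cast_one, hb, Pi.mul_apply, Pi.natCast_apply]
    push_cast
    rw [eq_inv_mul_iff_mul_eq₀ hi, Finset.sum_congr rfl fun x _ => mul_comm _ (((i + 1).choose x : ℕ) : ℂ)]
    ring

/-- The function `l ↦ 1 / (l + 1 + a)^s`. -/
noncomputable def pole (a s : ℕ) : ℕ → ℂ := fun l => (((l : ℂ) + 1 + a) ^ s)⁻¹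

lemma pole_eq_gen (r a s : ℕ) : pole (r + a) s = gen r 0 (Multiset.replicate s a) := by
  funext l
  simp [pole, gen, add_assoc]

lemma pole_mem_Cls {a s : ℕ} {e : ℤ} (h : 1 ≤ s + e) : pole a s ∈ Cls K e := by
  rw [← zero_add a, pole_eq_gen]
  exact gen_mem_Cls _ _ _ (by simpa using h)

lemma pole_sub_pole_mem (a b : ℕ) {s : ℕ} (hs : 1 ≤ s) :
    pole a s - pole b s ∈ (Cls K 0).map (fdiff K) := by
  suffices h : ∀ a, pole a s - pole 0 s ∈ (Cls K 0).map (fdiff K) by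
    simpa using Submodule.sub_mem _ (h a) (h b)
  intro a
  induction a with
  | zero => simp
  | succ a ih =>
    have h1 : fdiff K (pole a s) ∈ (Cls K 0).map (fdiff K) :=
      Submodule.mem_map_of_mem (pole_mem_Cls (by omega))
    convert Submodule.add_mem _ h1 ih using 1
    funext l
    simp only [Pi.sub_apply, Pi.add_apply, fdiff_apply, pole]
    push_cast
    ring_nf

/-! ### Formal partial fraction expansions -/

/-- The functions occurring in a partial fraction expansion: monomials and polar terms. -/
noncomputable def term (r : ℕ) : ℕ ⊕ ℕ × ℕ → ℕ → ℂ :=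
  Sum.elim (fun f l => ((l : ℂ) + 1) ^ f) (fun sj => pole (r + sj.2) sj.1)

/-- The function represented by a formal partial fraction expansion. -/
noncomputable def ev (K : Subfield ℂ) (r : ℕ) : (ℕ ⊕ ℕ × ℕ →₀ K) →ₗ[K] (ℕ → ℂ) :=
  Finsupp.linearCombination K (term r)

/-- For each exponent `s`, the sum over all poles of the coefficients of order `s`. -/
noncomputable def bar (K : Subfield ℂ) : (ℕ ⊕ ℕ × ℕ →₀ K) →ₗ[K] (ℕ →₀ K) :=
  Finsupp.linearCombination K (Sum.elim 0 fun sj => Finsupp.single sj.1 1)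

/-- The polar part with all poles moved to `-1 - b`. -/
noncomputable def lead (K : Subfield ℂ) (b : ℕ) : (ℕ ⊕ ℕ × ℕ →₀ K) →ₗ[K] (ℕ → ℂ) :=
  (Finsupp.linearCombination K (pole b)).comp (bar K)

/-- Formal expansions of functions of degree at most `e - 1`, with polar terms in `B`. -/
noncomputable def Adm (K : Subfield ℂ) (e : ℤ) (B : Set (ℕ × ℕ)) :
    Submodule K (ℕ ⊕ ℕ × ℕ →₀ K) :=
  Finsupp.supported K K {w | Sum.elim (fun f : ℕ => (f : ℤ) + 1 ≤ e) (fun sj => sj ∈ B) w} ⊓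
    ⨅ _ : e ≤ -1, LinearMap.ker ((Finsupp.lapply 1).comp (bar K))

lemma mem_Adm {e : ℤ} {B : Set (ℕ × ℕ)} {c : ℕ ⊕ ℕ × ℕ →₀ K} :
    c ∈ Adm K e B ↔ c ∈ Finsupp.supported K K
      {w | Sum.elim (fun f : ℕ => (f : ℤ) + 1 ≤ e) (fun sj => sj ∈ B) w} ∧
      (e ≤ -1 → bar K c 1 = 0) := by
  simp [Adm]

lemma Adm_mono {e : ℤ} {B B' : Set (ℕ × ℕ)} (h : B ⊆ B') : Adm K e B ≤ Adm K e B' := by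
  refine inf_le_inf_right _ (Finsupp.supported_mono ?_)
  rintro (f | sj) hw
  · exact hw
  · exact h hw

lemma linearCombination_mem {ι : Type*} {M : Type*} [AddCommGroup M] [Module K M] {S : Set ι}
    {c : ι →₀ K} (hc : c ∈ Finsupp.supported K K S) {v : ι → M} {N : Submodule K M}
    (h : ∀ w ∈ S, v w ∈ N) : Finsupp.linearCombination K v c ∈ N := by
  rw [Finsupp.linearCombination_apply]
  exact Submodule.sum_mem _ fun w hw => N.smul_mem _ (h w (hc hw))

lemma linearCombination_sub_apply {ι : Type*} {M : Type*} [AddCommGroup M] [Module K M]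
    (v w : ι → M) (c : ι →₀ K) : Finsupp.linearCombination K v c - Finsupp.linearCombination K w c =
      Finsupp.linearCombination K (v - w) c := by
  simp [Finsupp.linearCombination_apply, Finsupp.sum, smul_sub, sum_sub_distrib]

lemma exists_expansion_of_ne_zero (r : ℕ) (m : Multiset ℕ) (hm : m ≠ 0) :
    ∃ c ∈ Finsupp.supported K K
      {w | Sum.elim (fun _ : ℕ => False) (fun sj => 1 ≤ sj.1 ∧ sj.1 ≤ m.count sj.2) w},
      ev K r c = gen r 0 m ∧ bar K c 1 = if m.card = 1 then 1 else 0 := by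
  induction m using Multiset.strongInductionOn with
  | _ m ih =>
    by_cases hrep : ∃ a, m = Multiset.replicate m.card a
    · obtain ⟨a, ha⟩ := hrep
      refine ⟨Finsupp.single (Sum.inr (m.card, a)) 1, ?_, ?_, ?_⟩
      · refine Finsupp.single_mem_supported _ _ ?_
        have : m.count a = m.card := by
          conv_lhs => rw [ha]
          exact Multiset.count_replicate_self _ _
        exact ⟨Multiset.card_pos.2 hm, this.ge⟩
      · rw [ev, Finsupp.linearCombination_single, one_smul, term, Sum.elim_inr, pole_eq_gen, ← ha]
      · rw [bar, Finsupp.linearCombination_single, one_smul, Sum.elim_inr, Finsupp.single_apply]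
    · obtain ⟨a, ha⟩ := Multiset.exists_mem_of_ne_zero hm
      obtain ⟨t, rfl⟩ := Multiset.exists_cons_of_mem ha
      obtain ⟨b, hb, hba⟩ : ∃ b ∈ t, b ≠ a := by
        by_contra! h
        refine hrep ⟨a, Multiset.eq_replicate.2 ⟨rfl, fun x hx => ?_⟩⟩
        rcases Multiset.mem_cons.1 hx with rfl | hx
        · rfl
        · exact h x hx
      obtain ⟨u, rfl⟩ := Multiset.exists_cons_of_mem hb
      have hlt1 : a ::ₘ u < a ::ₘ b ::ₘ u := Multiset.cons_lt_cons a (Multiset.lt_cons_self u b)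
      have hlt2 : b ::ₘ u < a ::ₘ b ::ₘ u := Multiset.lt_cons_self _ a
      obtain ⟨c₁, hc₁, he₁, hb₁⟩ := ih _ hlt1 (Multiset.cons_ne_zero)
      obtain ⟨c₂, hc₂, he₂, hb₂⟩ := ih _ hlt2 (Multiset.cons_ne_zero)
      have hmono : ∀ {m' : Multiset ℕ}, m' ≤ a ::ₘ b ::ₘ u →
          Finsupp.supported K K
            {w | Sum.elim (fun _ : ℕ => False) (fun sj : ℕ × ℕ => 1 ≤ sj.1 ∧ sj.1 ≤ m'.count sj.2) w} ≤
          Finsupp.supported K K {w | Sum.elim (fun _ : ℕ => False)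
            (fun sj : ℕ × ℕ => 1 ≤ sj.1 ∧ sj.1 ≤ (a ::ₘ b ::ₘ u).count sj.2) w} := by
        intro m' hm'
        refine Finsupp.supported_mono ?_
        rintro (f | sj) hw
        · exact hw
        · exact ⟨hw.1, hw.2.trans (Multiset.count_le_of_le _ hm')⟩
      refine ⟨((b : K) - a)⁻¹ • (c₁ - c₂), Submodule.smul_mem _ _ (Submodule.sub_mem _
        (hmono hlt1.le hc₁) (hmono hlt2.le hc₂)), ?_, ?_⟩
      · rw [map_smul, map_sub, he₁, he₂]
        funext l
        have h1 : (l : ℂ) + 1 + r + a ≠ 0 := by exact_mod_cast (by omega : l + 1 + r + a ≠ 0)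
        have h2 : (l : ℂ) + 1 + r + b ≠ 0 := by exact_mod_cast (by omega : l + 1 + r + b ≠ 0)
        have h3 : (b : ℂ) - a ≠ 0 := sub_ne_zero.2 (by exact_mod_cast hba)
        simp only [Pi.smul_apply, Pi.sub_apply, gen, Subfield.smul_def, smul_eq_mul, pow_zero,
          one_mul, Multiset.map_cons, Multiset.prod_cons, mul_inv]
        push_cast
        generalize ((u.map fun j : ℕ => (l : ℂ) + 1 + r + j).prod)⁻¹ = x
        field_simp
        ring
      · rw [map_smul, map_sub, Finsupp.smul_apply, Finsupp.sub_apply, hb₁, hb₂]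
        simp

lemma gen_mem_map_ev {r : ℕ} {e : ℤ} {B : Set (ℕ × ℕ)} (i : ℕ) (m : Multiset ℕ)
    (hB : ∀ s j, 1 ≤ s → s ≤ m.count j → (s, j) ∈ B) (h : (i : ℤ) + 1 ≤ m.card + e) :
    gen r i m ∈ (Adm K e B).map (ev K r) := by
  induction i generalizing m with
  | zero =>
    rcases eq_or_ne m 0 with rfl | hm
    · refine ⟨Finsupp.single (Sum.inl 0) 1, mem_Adm.2 ⟨?_, ?_⟩, ?_⟩
      · exact Finsupp.single_mem_supported _ _
          (show ((0 : ℕ) : ℤ) + 1 ≤ e by simpa using h)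
      · intro he
        simp at h
        omega
      · funext l
        simp [ev, term, gen]
    · obtain ⟨c, hc, hce, hcb⟩ := exists_expansion_of_ne_zero (K := K) r m hm
      refine ⟨c, mem_Adm.2 ⟨Finsupp.supported_mono ?_ hc, fun he => ?_⟩, hce⟩
      · rintro (f | ⟨s, j⟩) hw
        · exact hw.elim
        · exact hB s j hw.1 hw.2
      · rw [hcb, if_neg]
        push_cast at h
        omega
  | succ i ih =>
    rcases m.empty_or_exists_mem with rfl | ⟨a, ha⟩
    · refine ⟨Finsupp.single (Sum.inl (i + 1)) 1, mem_Adm.2 ⟨?_, ?_⟩, ?_⟩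
      · exact Finsupp.single_mem_supported _ _ (by simpa using h)
      · intro he
        simp at h
        omega
      · funext l
        simp [ev, term, gen]
    · obtain ⟨t, rfl⟩ := Multiset.exists_cons_of_mem ha
      have h1 := ih t (fun s j hs hst => hB s j hs
        (hst.trans (Multiset.count_le_of_le _ (Multiset.le_cons_self t a))))
        (by rw [Multiset.card_cons] at h; push_cast at h; omega)
      have h2 := ih (a ::ₘ t) hB (by push_cast at h ⊢; omega)
      convert Submodule.sub_mem _ h1 (Submodule.smul_mem _ ((r : K) + a) h2) using 1
      funext l
      have h1 : (l : ℂ) + 1 + r + a ≠ 0 := by exact_mod_cast (by omega : l + 1 + r + a ≠ 0)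
      simp only [Pi.smul_apply, Pi.sub_apply, gen, Subfield.smul_def, smul_eq_mul,
        Multiset.map_cons, Multiset.prod_cons, mul_inv]
      push_cast
      generalize ((t.map fun j : ℕ => (l : ℂ) + 1 + r + j).prod)⁻¹ = x
      field_simp
      ring

lemma Cls_le_map_ev (e : ℤ) : Cls K e ≤ (Adm K e {sj | 1 ≤ sj.1}).map (ev K 0) := by
  refine Submodule.span_le.2 ?_
  rintro _ ⟨i, m, him, rfl⟩
  exact gen_mem_map_ev i m (fun _ _ hs _ => hs) him

/-- The polar part of a formal partial fraction expansion. -/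
noncomputable def polar (K : Subfield ℂ) (r : ℕ) : (ℕ ⊕ ℕ × ℕ →₀ K) →ₗ[K] (ℕ → ℂ) :=
  Finsupp.linearCombination K (Sum.elim 0 fun sj => pole (r + sj.2) sj.1)

lemma ev_sub_polar_mem {e : ℤ} {c : ℕ ⊕ ℕ × ℕ →₀ K} (hc : c ∈ Adm K e {sj | 1 ≤ sj.1})
    (r : ℕ) : ev K r c - polar K r c ∈ (Cls K (e + 1)).map (fdiff K) := by
  rw [ev, polar, linearCombination_sub_apply]
  refine linearCombination_mem (mem_Adm.1 hc).1 ?_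
  rintro (f | sj) hw
  · have hw' : (f : ℤ) + 1 ≤ e := hw
    simpa [term] using Submodule.map_mono (Cls_mono (by omega)) (pow_mem_map_fdiff (K := K) f)
  · simp [term]

lemma polar_mem_Cls_zero {e : ℤ} {c : ℕ ⊕ ℕ × ℕ →₀ K} (hc : c ∈ Adm K e {sj | 1 ≤ sj.1})
    (r : ℕ) : polar K r c ∈ Cls K 0 := by
  refine linearCombination_mem (mem_Adm.1 hc).1 ?_
  rintro (f | sj) hw
  · simp
  · exact pole_mem_Cls (by have : 1 ≤ sj.1 := hw; omega)

lemma ev_eq_polar {e : ℤ} {c : ℕ ⊕ ℕ × ℕ →₀ K} (hc : c ∈ Adm K e {sj | 1 ≤ sj.1})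
    (he : e ≤ 0) (r : ℕ) : ev K r c = polar K r c := by
  rw [← sub_eq_zero, ev, polar, linearCombination_sub_apply,
    ← Submodule.mem_bot K]
  refine linearCombination_mem (mem_Adm.1 hc).1 ?_
  rintro (f | sj) hw
  · have hw' : (f : ℤ) + 1 ≤ e := hw
    omega
  · simp [term]

lemma polar_sub_lead_mem {e : ℤ} {c : ℕ ⊕ ℕ × ℕ →₀ K} (hc : c ∈ Adm K e {sj | 1 ≤ sj.1})
    (r b : ℕ) : polar K r c - lead K b c ∈ (Cls K 0).map (fdiff K) := by
  have : lead K b = Finsupp.linearCombination K (Sum.elim 0 fun sj : ℕ × ℕ => pole b sj.1) := by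
    refine Finsupp.lhom_ext fun w x => ?_
    rcases w with f | sj <;> simp [lead, bar]
  rw [this, polar, linearCombination_sub_apply]
  refine linearCombination_mem (mem_Adm.1 hc).1 ?_
  rintro (f | sj) hw
  · simp
  · exact pole_sub_pole_mem _ _ hw

lemma bar_mem_supported {e : ℤ} {c : ℕ ⊕ ℕ × ℕ →₀ K} (hc : c ∈ Adm K e {sj | 1 ≤ sj.1})
    : bar K c ∈ Finsupp.supported K K {s | 1 ≤ s} := by
  refine linearCombination_mem (mem_Adm.1 hc).1 ?_
  rintro (f | sj) hw
  · simp
  · exact Finsupp.single_mem_supported _ _ hw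

lemma bar_mem_supported_two {e : ℤ} {c : ℕ ⊕ ℕ × ℕ →₀ K} (hc : c ∈ Adm K e {sj | 1 ≤ sj.1})
    (he : e ≤ -1) : bar K c ∈ Finsupp.supported K K {s | 2 ≤ s} := by
  intro s hs
  have h1 : 1 ≤ s := bar_mem_supported hc hs
  have h2 : s ≠ 1 := by
    rintro rfl
    exact Finsupp.mem_support_iff.1 hs ((mem_Adm.1 hc).2 he)
  exact show 2 ≤ s by omega

lemma lead_mem_Cls_zero {e : ℤ} {c : ℕ ⊕ ℕ × ℕ →₀ K} (hc : c ∈ Adm K e {sj | 1 ≤ sj.1})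
    (b : ℕ) : lead K b c ∈ Cls K 0 :=
  linearCombination_mem (bar_mem_supported hc) fun s hs =>
    pole_mem_Cls (by have : 1 ≤ s := hs; omega)

lemma lead_mem_Cls_neg_one {e : ℤ} {c : ℕ ⊕ ℕ × ℕ →₀ K} (hc : c ∈ Adm K e {sj | 1 ≤ sj.1})
    (he : e ≤ -1) (b : ℕ) : lead K b c ∈ Cls K (-1) :=
  linearCombination_mem (bar_mem_supported_two hc he) fun s hs =>
    pole_mem_Cls (by have : 2 ≤ s := hs; omega)

lemma nested_ev_sub_nested_lead_mem {q : ℕ} (hq : LimitsInSpan K q) (r b : Fin (q + 1) → ℕ)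
    (E : Fin (q + 1) → ℤ) (c : Fin (q + 1) → ℕ ⊕ ℕ × ℕ →₀ K)
    (hc : ∀ i, c i ∈ Adm K (E i) {sj | 1 ≤ sj.1}) (hF : ∀ i, ev K (r i) (c i) ∈ Cls K (E i))
    (hneg : PartialSumsNeg 0 (List.ofFn E)) :
    nested (List.ofFn fun i => ev K (r i) (c i)) - nested (List.ofFn fun i => lead K (b i) (c i))
      ∈ Conv (mzvSpan K q) := by
  have hp0 := fun i => polar_mem_Cls_zero (hc i) (r i)
  have hpE : ∀ i, polar K (r i) (c i) ∈ Cls K (E i) := fun i => by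
    rcases le_total 0 (E i) with h | h
    · exact Cls_mono h (hp0 i)
    · rw [← ev_eq_polar (hc i) h]; exact hF i
  choose G hG hG' using fun i => ev_sub_polar_mem (hc i) (r i)
  choose G₂ hG₂ hG₂' using fun i => polar_sub_lead_mem (hc i) (r i) (b i)
  have hE0 : E 0 ≤ -1 := by
    rw [List.ofFn_succ, partialSumsNeg_cons] at hneg
    simpa using hneg.1
  have hl0 := lead_mem_Cls_neg_one (hc 0) hE0 (b 0)
  have hneg0 : ∀ l : List (Fin q), PartialSumsNeg 0 ([-1] ++ l.map fun _ => (0 : ℤ)) := fun l =>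
    ⟨by simp, partialSumsNeg_of_nonpos (by simp) (by simp)⟩
  have key : ∀ f : Fin (q + 1) → ℕ → ℂ,
      List.ofFn f = f 0 :: (List.finRange q).map fun i => f i.succ := fun f => by
    rw [List.ofFn_succ, List.ofFn_eq_map]
  simp only [key]
  have h1 := nested_congr_tail hq (fun i : Fin q => E i.succ)
    (fun i => ev K (r i.succ) (c i.succ)) (fun i => polar K (r i.succ) (c i.succ))
    (fun i => G i.succ) (fun i => hF _) (fun i => hpE _) (fun i => hG _)
    (fun i => by rw [hG', add_sub_cancel]) (List.finRange q) [(E 0, ev K (r 0) (c 0))] (by simp)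
    (by simp; omega) (by simpa using hF 0)
    (by rw [List.ofFn_succ, List.ofFn_eq_map] at hneg; exact hneg)
  have h2 := nested_fdiff_cons_mem hq
    ((List.finRange q).map fun i => polar K (r i.succ) (c i.succ)) (by simp)
    (by
      intro f hf
      obtain ⟨i, _, rfl⟩ := List.mem_map.1 hf
      exact hp0 _) (hG₂ 0)
  have h3 := nested_congr_tail hq (fun i : Fin q => 0)
    (fun i => polar K (r i.succ) (c i.succ)) (fun i => lead K (b i.succ) (c i.succ))
    (fun i => G₂ i.succ) (fun i => hp0 _) (fun i => lead_mem_Cls_zero (hc _) _)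
    (fun i => Cls_mono (by simp) (hG₂ _))
    (fun i => by rw [hG₂', add_sub_cancel]) (List.finRange q) [(-1, lead K (b 0) (c 0))] (by simp)
    (by simp; omega) (by simpa using hl0) (hneg0 _)
  have h4 : ∀ fs, nested (ev K (r 0) (c 0) :: fs) =
      nested (fdiff K (G₂ 0) :: fs) + nested (lead K (b 0) (c 0) :: fs) := fun fs => by
    rw [ev_eq_polar (hc 0) (by omega), ← sub_add_cancel (polar K (r 0) (c 0)) (lead K (b 0) (c 0)),
      ← hG₂' 0]
    exact nested_append_add_cons [] _ _ _
  convert Submodule.add_mem _ (Submodule.add_mem _ h1 h2) h3 using 1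
  simp only [List.map_cons, List.map_nil, List.singleton_append, h4]
  abel

/-! ### Nested sums as multiple series -/

lemma antitone_cons {p : ℕ} (x : ℕ) (l : Fin p → ℕ) :
    Antitone (Fin.cons x l : Fin (p + 1) → ℕ) ↔ (∀ i, l i ≤ x) ∧ Antitone l := by
  constructor
  · intro h
    refine ⟨fun i => ?_, fun i j hij => ?_⟩
    · simpa using h (Fin.zero_le i.succ)
    · simpa using h (Fin.succ_le_succ_iff.2 hij)
  · rintro ⟨h1, h2⟩ i j hij
    induction i using Fin.cases with
    | zero =>
      induction j using Fin.cases with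
      | zero => exact le_rfl
      | succ j => simpa using h1 j
    | succ i =>
      induction j using Fin.cases with
      | zero => simp at hij
      | succ j => simpa using h2 (Fin.succ_le_succ_iff.1 hij)

open Classical in
lemma nested_ofFn {p : ℕ} (F : Fin p → ℕ → ℂ) (N : ℕ) :
    nested (List.ofFn F) N = ∑ l ∈ Fintype.piFinset (fun _ : Fin p => range (N + 1)) with Antitone l,
      ∏ i, F i (l i) := by
  induction p generalizing N with
  | zero =>
    have h : ∀ l : Fin 0 → ℕ, Antitone l := fun l i => i.elim0
    simp [nested_nil, h]
  | succ p ih =>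
    rw [List.ofFn_succ, nested_cons]
    simp only [op, ih, mul_sum]
    rw [sum_sigma']
    refine sum_bij' (fun x _ => (Fin.cons x.1 x.2 : Fin (p + 1) → ℕ))
      (fun l _ => ⟨l 0, Fin.tail l⟩) ?_ ?_ ?_ ?_ ?_
    · rintro ⟨x, l⟩ h
      simp only [mem_sigma, mem_range, mem_filter, Fintype.mem_piFinset, Nat.lt_succ_iff] at h ⊢
      refine ⟨fun i => ?_, (antitone_cons _ _).2 h.2⟩
      induction i using Fin.cases with
      | zero => simpa using h.1
      | succ i => simpa using (h.2.1 i).trans h.1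
    · intro l h
      simp only [mem_sigma, mem_range, mem_filter, Fintype.mem_piFinset, Nat.lt_succ_iff] at h ⊢
      obtain ⟨h1, h2⟩ := h
      rw [← Fin.cons_self_tail l, antitone_cons] at h2
      exact ⟨h1 0, h2⟩
    · rintro ⟨x, l⟩ _; simp
    · intro l _; simp
    · rintro ⟨x, l⟩ _; simp [Fin.prod_univ_succ]

open Classical in
lemma tendsto_nested_ofFn {p : ℕ} {F : Fin p → ℕ → ℂ}
    (h : Summable fun l : {l : Fin p → ℕ // Antitone l} => ∏ i, F i (l.1 i)) :
    Tendsto (nested (List.ofFn F)) atTop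
      (𝓝 (∑' l : {l : Fin p → ℕ // Antitone l}, ∏ i, F i (l.1 i))) := by
  have hbox : Tendsto (fun N => (Fintype.piFinset fun _ : Fin p => range (N + 1)).subtype Antitone)
      atTop atTop := by
    refine tendsto_atTop_finset_of_monotone (fun a b hab l hl => ?_) fun l => ⟨∑ i, l.1 i, ?_⟩
    · simp only [mem_subtype, Fintype.mem_piFinset, mem_range] at hl ⊢
      exact fun i => (hl i).trans_le (by omega)
    · simp only [mem_subtype, Fintype.mem_piFinset, mem_range, Nat.lt_succ_iff]
      exact fun i => single_le_sum (fun j _ => Nat.zero_le (l.1 j)) (mem_univ i)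
  refine (h.hasSum.comp hbox).congr fun N => ?_
  simp only [Function.comp_apply]
  rw [nested_ofFn, ← sum_subtype_eq_sum_filter]

/-! ### Absolute convergence -/

lemma sum_mul_nonpos_of_partialSumsNeg {p : ℕ} (E : Fin p → ℤ) (c : ℤ) {d δ : ℝ} (hδ : 0 ≤ δ)
    (hd : d + p * δ ≤ 1) (hcd : c + d ≤ 0) (hE : PartialSumsNeg c (List.ofFn E)) {X : ℝ}
    (hX : 0 ≤ X) {x : Fin p → ℝ} (hx : Antitone x) (hx0 : ∀ i, 0 ≤ x i) (hxX : ∀ i, x i ≤ X) :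
    (c + d) * X + ∑ i, (E i + δ) * x i ≤ 0 := by
  induction p generalizing c d X with
  | zero => simpa using mul_nonpos_of_nonpos_of_nonneg hcd hX
  | succ p ih =>
    rw [List.ofFn_succ, partialSumsNeg_cons] at hE
    push_cast at hd
    have hp : 0 ≤ (p : ℝ) * δ := by positivity
    have h1 : ((c + E 0 : ℤ) : ℝ) ≤ -1 := by exact_mod_cast hE.1
    have := ih (fun i => E i.succ) (c + E 0) (d := d + δ) (by linarith) (by linarith) hE.2
      (hx0 0) (x := fun i => x i.succ) (fun i j hij => hx (Fin.succ_le_succ_iff.2 hij))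
      (fun i => hx0 _) (fun i => hx (Fin.zero_le _))
    rw [Fin.sum_univ_succ]
    push_cast at this
    nlinarith [mul_le_mul_of_nonpos_left (hxX 0) hcd]

lemma summable_prod_apply {g : ℕ → ℝ} (hg : Summable g) (h0 : ∀ n, 0 ≤ g n) (p : ℕ) :
    Summable fun f : Fin p → ℕ => ∏ i, g (f i) := by
  induction p with
  | zero => exact Summable.of_finite
  | succ p ih =>
    rw [← (Fin.consEquiv fun _ : Fin (p + 1) => ℕ).summable_iff]
    refine (hg.mul_of_nonneg ih h0 fun f => prod_nonneg fun i _ => h0 _).congr fun x => ?_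
    simp [Fin.consEquiv, Fin.prod_univ_succ]

lemma summable_prod_of_mem_Cls {p : ℕ} {E : Fin p → ℤ} {F : Fin p → ℕ → ℂ}
    (hF : ∀ i, F i ∈ Cls K (E i)) (hE : PartialSumsNeg 0 (List.ofFn E)) :
    Summable fun l : {l : Fin p → ℕ // Antitone l} => ∏ i, F i (l.1 i) := by
  choose C hC hFC using fun i => exists_norm_le (hF i)
  set δ : ℝ := ((p : ℝ) + 1)⁻¹ with hδ
  have hδ0 : 0 < δ := by positivity
  have hg : Summable fun n : ℕ => ((n : ℝ) + 1) ^ (-(1 + δ)) := by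
    have := (summable_nat_add_iff 1).2 (Real.summable_nat_rpow (p := -(1 + δ)) |>.2 (by linarith))
    simpa using this
  have hs := ((summable_prod_apply hg (fun n => by positivity) p).subtype {l | Antitone l}).mul_left
    (∏ i, C i)
  refine Summable.of_norm_bounded hs fun l => ?_
  rw [norm_prod]
  refine (prod_le_prod (fun i _ => norm_nonneg _) fun i _ => hFC i (l.1 i)).trans ?_
  rw [prod_mul_distrib]
  refine mul_le_mul_of_nonneg_left ?_ (prod_nonneg fun i _ => hC i)
  simp only [Function.comp_apply]
  have hpos : ∀ i, (0 : ℝ) < (l.1 i : ℝ) + 1 := fun i => by positivity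
  have h1 : ∀ (i) (e : ℝ), ((l.1 i : ℝ) + 1) ^ e = Real.exp (Real.log ((l.1 i : ℝ) + 1) * e) :=
    fun i e => Real.rpow_def_of_pos (hpos i) e
  have hx0 : ∀ i, 0 ≤ Real.log ((l.1 i : ℝ) + 1) := fun i => Real.log_nonneg (by simp)
  have key := sum_mul_nonpos_of_partialSumsNeg E 0 (d := 0) hδ0.le
    (by rw [hδ, zero_add, ← div_eq_mul_inv, div_le_one (by positivity)]; linarith) (by simp) hE
    (sum_nonneg fun i _ => hx0 i)
    (x := fun i => Real.log ((l.1 i : ℝ) + 1))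
    (fun i j hij => Real.log_le_log (hpos j) (by have := l.2 hij; gcongr))
    hx0 (fun i => single_le_sum (fun j _ => hx0 j) (mem_univ i))
  simp only [← Real.rpow_intCast, h1, ← Real.exp_sum]
  refine Real.exp_le_exp.2 (sub_nonpos.1 ?_)
  rw [← sum_sub_distrib]
  refine le_of_eq_of_le ?_ key
  simp only [Int.cast_zero, zero_add, zero_mul]
  refine sum_congr rfl fun i _ => ?_
  push_cast
  ring

/-! ### Multiple zeta values as limits of nested sums -/

/-- Antitone tuples of naturals correspond to strictly antitone tuples of positive integers. -/
def antitoneEquivStrictAnti (p : ℕ) : {l : Fin p → ℕ // Antitone l} ≃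
    {k : Fin p → ℕ // StrictAnti k ∧ ∀ i, 1 ≤ k i} where
  toFun l := ⟨fun i => l.1 i + (p - i), fun i j hij => by
    have h1 := l.2 hij.le
    have h2 : i.1 < j.1 := hij
    have := j.2
    show l.1 j + (p - j) < l.1 i + (p - i)
    omega, fun i => by have := i.2; show 1 ≤ l.1 i + (p - i); omega⟩
  invFun k := ⟨fun i => k.1 i - (p - i), by
    have aux : ∀ {m : ℕ} (k : Fin m → ℕ), StrictAnti k → Antitone fun i => k i - (m - i) := by
      intro m k hk
      cases m with
      | zero => exact fun i => i.elim0
      | succ m =>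
        refine Fin.antitone_iff_succ_le.2 fun i => ?_
        have := hk (Fin.castSucc_lt_succ (i := i))
        have := i.2
        simp only [Fin.val_succ, Fin.val_castSucc]
        omega
    exact aux k.1 k.2.1⟩
  left_inv l := by
    ext i
    simp
  right_inv k := by
    have aux : ∀ {m : ℕ} (k : Fin m → ℕ), StrictAnti k → (∀ i, 1 ≤ k i) → ∀ i, m - i ≤ k i := by
      intro m k hk h1 i
      cases m with
      | zero => exact i.elim0
      | succ m =>
        induction i using Fin.reverseInduction with
        | last => simpa using h1 _
        | cast i ih =>
          have := hk (Fin.castSucc_lt_succ (i := i))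
          simp only [Fin.val_succ, Fin.val_castSucc] at ih ⊢
          omega
    ext i
    exact Nat.sub_add_cancel (aux k.1 k.2.1 k.2.2 i)

lemma tsum_prod_pole (p : ℕ) (t : Fin p → ℕ) :
    ∑' l : {l : Fin p → ℕ // Antitone l}, ∏ i : Fin p, pole (p - 1 - i) (t i) (l.1 i) =
      (mzv (List.ofFn t) : ℂ) := by
  have h : ∀ s : List ℕ, s = List.ofFn t → ((mzv s : ℝ) : ℂ) =
      ∑' k : {k : Fin p → ℕ // StrictAnti k ∧ ∀ i, 1 ≤ k i}, ∏ i, ((k.1 i : ℂ) ^ t i)⁻¹ := by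
    intro s hs
    obtain rfl : p = s.length := by simp [hs]
    obtain rfl : t = s.get := by
      rw [← List.ofFn_inj, ← hs, List.ofFn_get]
    rw [mzv, Complex.ofReal_tsum]
    push_cast
    rfl
  rw [h _ rfl, ← (antitoneEquivStrictAnti p).tsum_eq]
  refine tsum_congr fun l => prod_congr rfl fun i _ => ?_
  have : l.1 i + (p - i) = l.1 i + 1 + (p - 1 - i) := by have := i.2; omega
  simp only [pole, antitoneEquivStrictAnti, Equiv.coe_fn_mk, this]
  push_cast
  rfl

lemma tendsto_nested_pole {p : ℕ} {t : Fin p → ℕ} (h1 : ∀ i, 1 ≤ t i)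
    (h2 : ∀ i : Fin p, i.1 = 0 → 2 ≤ t i) :
    Tendsto (nested (List.ofFn fun i : Fin p => pole (p - 1 - i) (t i))) atTop
      (𝓝 (mzv (List.ofFn t) : ℂ)) := by
  rw [← tsum_prod_pole]
  refine tendsto_nested_ofFn (summable_prod_of_mem_Cls (K := ⊥)
    (E := fun i => if i.1 = 0 then -1 else 0) (fun i => pole_mem_Cls ?_) ?_)
  · split_ifs with h
    · have := h2 i h; omega
    · have := h1 i; omega
  · cases p with
    | zero => exact partialSumsNeg_nil 0
    | succ p =>
      rw [List.ofFn_succ, partialSumsNeg_cons]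
      exact ⟨by simp, partialSumsNeg_of_nonpos (by simp) (by simp)⟩

lemma nested_ofFn_sum {p : ℕ} {ι : Type*} [DecidableEq ι] (S : Fin p → Finset ι) (a : Fin p → ι → ℂ)
    (f : Fin p → ι → ℕ → ℂ) (N : ℕ) :
    nested (List.ofFn fun i => ∑ s ∈ S i, a i s • f i s) N =
      ∑ s ∈ Fintype.piFinset S, (∏ i, a i (s i)) * nested (List.ofFn fun i => f i (s i)) N := by
  classical
  simp only [nested_ofFn, mul_sum, ← prod_mul_distrib]
  rw [sum_comm]
  refine sum_congr rfl fun l _ => ?_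
  simp only [Finset.sum_apply, Pi.smul_apply, smul_eq_mul]
  exact prod_univ_sum S fun i s => a i s * f i s (l i)

lemma tendsto_nested_lead {p : ℕ} {c : Fin p → ℕ ⊕ ℕ × ℕ →₀ K} {S : Fin p → Finset ℕ}
    (hS : ∀ i, (bar K (c i)).support ⊆ S i) (h1 : ∀ i, ∀ s ∈ S i, 1 ≤ s)
    (h2 : ∀ i : Fin p, i.1 = 0 → ∀ s ∈ S i, 2 ≤ s) :
    Tendsto (nested (List.ofFn fun i : Fin p => lead K (p - 1 - i) (c i))) atTop
      (𝓝 (∑ s ∈ Fintype.piFinset S,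
        (∏ i, (bar K (c i) (s i) : ℂ)) * (mzv (List.ofFn s) : ℂ))) := by
  have h : ∀ i : Fin p, lead K (p - 1 - i) (c i) =
      ∑ s ∈ S i, (bar K (c i) s : ℂ) • pole (p - 1 - i) s := fun i => by
    rw [lead, LinearMap.comp_apply, Finsupp.linearCombination_apply,
      Finsupp.sum_of_support_subset _ (hS i) _ (by simp)]
    rfl
  simp only [h]
  refine Tendsto.congr (fun N => (nested_ofFn_sum S _ _ N).symm) ?_
  refine tendsto_finsetSum _ fun s hs => Tendsto.const_mul _ (tendsto_nested_pole ?_ ?_)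
  · exact fun i => h1 i _ (Fintype.mem_piFinset.1 hs i)
  · exact fun i hi => h2 i hi _ (Fintype.mem_piFinset.1 hs i)

lemma mzv_ofFn_mem_mzvSpan {p : ℕ} {t : Fin p → ℕ} (h1 : ∀ i, 1 ≤ t i)
    (h2 : ∀ i : Fin p, i.1 = 0 → 2 ≤ t i) : (mzv (List.ofFn t) : ℂ) ∈ mzvSpan K p := by
  refine Submodule.subset_span ⟨List.ofFn t, ⟨by simp, by simpa [List.mem_ofFn] using h1, ?_⟩, rfl⟩
  cases p with
  | zero => simp
  | succ p => simpa using h2 0 rfl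

lemma PartialSumsNeg.head_le {p : ℕ} {E : Fin p → ℤ} (h : PartialSumsNeg 0 (List.ofFn E))
    (i : Fin p) (hi : i.1 = 0) : E i ≤ -1 := by
  cases p with
  | zero => exact i.elim0
  | succ p =>
    obtain rfl : i = 0 := Fin.ext hi
    rw [List.ofFn_succ, partialSumsNeg_cons] at h
    simpa using h.1

lemma nested_lead_mem_Conv {p : ℕ} {E : Fin p → ℤ} {c : Fin p → ℕ ⊕ ℕ × ℕ →₀ K}
    (hc : ∀ i, c i ∈ Adm K (E i) {sj | 1 ≤ sj.1}) (hneg : PartialSumsNeg 0 (List.ofFn E)) :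
    nested (List.ofFn fun i : Fin p => lead K (p - 1 - i) (c i)) ∈ Conv (mzvSpan K p) := by
  have h1 : ∀ i, ∀ s ∈ (bar K (c i)).support, 1 ≤ s := fun i s hs => bar_mem_supported (hc i) hs
  have h2 : ∀ i : Fin p, i.1 = 0 → ∀ s ∈ (bar K (c i)).support, 2 ≤ s :=
    fun i hi s hs => bar_mem_supported_two (hc i) (hneg.head_le i hi) hs
  refine mem_Conv.2 ⟨_, Submodule.sum_mem _ fun s hs => ?_, tendsto_nested_lead
    (fun i => Subset.rfl) h1 h2⟩
  have hs' := Fintype.mem_piFinset.1 hs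
  have := Submodule.smul_mem _ (∏ i, bar K (c i) (s i))
    (mzv_ofFn_mem_mzvSpan (K := K) (fun i => h1 i _ (hs' i)) fun i hi => h2 i hi _ (hs' i))
  simpa [Subfield.smul_def] using this

/-- Convergent nested sums of depth at most `q` of functions in `Cls` are combinations of multiple
zeta values of depth at most `q`. -/
lemma limitsInSpan (K : Subfield ℂ) (q : ℕ) : LimitsInSpan K q := by
  induction q with
  | zero =>
    intro L hL _ _
    obtain rfl := List.length_eq_zero_iff.1 (Nat.le_zero.1 hL)
    exact const_mem_Conv 0 1
  | succ q ih =>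
    intro L hL hLC hneg
    rcases Nat.lt_or_ge q L.length with hlt | hle
    swap
    · exact Conv_mono (mzvSpan_mono q.le_succ) (ih L hle hLC hneg)
    obtain ⟨x, rfl⟩ : ∃ x : Fin (q + 1) → ℤ × (ℕ → ℂ), L = List.ofFn x := by
      exact ⟨fun i => L.get (i.cast (by omega)), List.ext_getElem (by simp; omega)
        fun i h1 h2 => by rw [List.getElem_ofFn]; rfl⟩
    simp only [List.map_ofFn] at hneg ⊢
    choose c hc hce using fun i => Cls_le_map_ev _ (hLC (x i) (List.mem_ofFn.2 ⟨i, rfl⟩))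
    have hF : ∀ i, ev K 0 (c i) ∈ Cls K (x i).1 := fun i => by
      rw [hce]; exact hLC (x i) (List.mem_ofFn.2 ⟨i, rfl⟩)
    have h1 := nested_ev_sub_nested_lead_mem ih (fun _ => 0) (fun i => q + 1 - 1 - i) _ c hc hF hneg
    have h2 := nested_lead_mem_Conv hc hneg
    have h3 := Submodule.add_mem _ (Conv_mono (mzvSpan_mono q.le_succ) h1) h2
    rw [sub_add_cancel] at h3
    simp only [hce] at h3
    exact h3

/-! ### Uniqueness of partial fraction expansions -/

/-- Products of functions from finitely linearly independent families are independent. -/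
lemma eq_zero_of_sum_prod_eq_zero {ι : Type*} [DecidableEq ι] (V : Set ι) {p : ℕ}
    (v : Fin p → ι → ℕ → ℂ)
    (hv : ∀ i, ∀ (T : Finset ι) (g : ι → ℂ), (∀ a ∈ T, a ∈ V) →
      (∀ x, ∑ a ∈ T, g a * v i a x = 0) → ∀ a ∈ T, g a = 0)
    (T : Finset (Fin p → ι)) (g : (Fin p → ι) → ℂ) (hT : ∀ w ∈ T, ∀ i, w i ∈ V)
    (hg : ∀ l : Fin p → ℕ, ∑ w ∈ T, g w * ∏ i, v i (w i) (l i) = 0) : ∀ w ∈ T, g w = 0 := by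
  induction p with
  | zero =>
    intro w hw
    obtain rfl : T = {w} := Finset.eq_singleton_iff_unique_mem.2
      ⟨hw, fun _ _ => Subsingleton.elim _ _⟩
    simpa using hg default
  | succ p ih =>
    have hG : ∀ (l : Fin p → ℕ), ∀ a ∈ T.image (· 0),
        ∑ w ∈ T with w 0 = a, g w * ∏ i, v i.succ (w i.succ) (l i) = 0 := by
      intro l
      refine hv 0 _ _ ?_ fun x => ?_
      · intro a ha
        obtain ⟨w, hw, rfl⟩ := mem_image.1 ha
        exact hT w hw 0
      · rw [← hg (Fin.cons x l), ← sum_fiberwise_of_maps_to (g := fun w : Fin (p + 1) → ι => w 0)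
          fun w hw => mem_image_of_mem _ hw]
        refine sum_congr rfl fun a _ => ?_
        rw [sum_mul]
        refine sum_congr rfl fun w hw => ?_
        rw [Fin.prod_univ_succ, ← (mem_filter.1 hw).2]
        simp only [Fin.cons_zero, Fin.cons_succ]
        ring
    intro w hw
    let tl : (Fin (p + 1) → ι) → Fin p → ι := fun u i => u i.succ
    have hcons : ∀ u : Fin (p + 1) → ι, (Fin.cons (u 0) (tl u) : Fin (p + 1) → ι) = u :=
      fun u => Fin.cons_self_tail u
    have := ih (fun i => v i.succ) (fun i => hv i.succ) ((T.filter (· 0 = w 0)).image tl)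
      (fun u => g (Fin.cons (w 0) u)) ?_ ?_ (tl w)
      (mem_image_of_mem _ (mem_filter.2 ⟨hw, rfl⟩))
    · simpa only [hcons] using this
    · intro u hu i
      obtain ⟨w', hw', rfl⟩ := mem_image.1 hu
      exact hT w' (mem_filter.1 hw').1 i.succ
    · intro l
      rw [← hG l (w 0) (mem_image_of_mem _ hw), sum_image]
      · refine sum_congr rfl fun w' hw' => ?_
        rw [← (mem_filter.1 hw').2, hcons]
      · intro w₁ h₁ w₂ h₂ h
        rw [← hcons w₁, ← hcons w₂, h, (mem_filter.1 h₁).2, (mem_filter.1 h₂).2]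

open Polynomial in
lemma polynomial_eq_zero_of_forall_nat (Q : ℂ[X]) (h : ∀ l : ℕ, Q.eval ((l : ℂ) + 1) = 0) :
    Q = 0 := by
  refine Q.eq_zero_of_infinite_isRoot (Set.infinite_of_injective_forall_mem
    (f := fun l : ℕ => (l : ℂ) + 1) (fun a b hab => by simpa using hab) h)

open Polynomial in
lemma coeff_pole_eq_zero (r : ℕ) (T : Finset (ℕ ⊕ ℕ × ℕ)) (g : ℕ ⊕ ℕ × ℕ → ℂ)
    (hT : ∀ w ∈ T, ∀ s j, w = Sum.inr (s, j) → 1 ≤ s)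
    (hg : ∀ l, ∑ w ∈ T, g w * term r w l = 0) (s j : ℕ) (hsj : Sum.inr (s, j) ∈ T) :
    g (Sum.inr (s, j)) = 0 := by
  classical
  by_contra hne
  -- a pole at `j` of maximal order
  obtain ⟨s₀, hs₀, hmax⟩ : ∃ s₀, (Sum.inr (s₀, j) ∈ T ∧ g (Sum.inr (s₀, j)) ≠ 0) ∧
      ∀ s, Sum.inr (s, j) ∈ T → g (Sum.inr (s, j)) ≠ 0 → s ≤ s₀ := by
    set U := (T.filter fun w => g w ≠ 0 ∧ ∃ s, w = Sum.inr (s, j)).image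
      (Sum.elim (fun _ => 0) Prod.fst) with hU
    have hmem : ∀ s, s ∈ U ↔ (Sum.inr (s, j) ∈ T ∧ g (Sum.inr (s, j)) ≠ 0) := by
      intro s
      rw [hU, mem_image]
      constructor
      · rintro ⟨w, hw, rfl⟩
        obtain ⟨hwT, hwg, s, rfl⟩ := mem_filter.1 hw
        exact ⟨hwT, hwg⟩
      · rintro ⟨h1, h2⟩
        exact ⟨_, mem_filter.2 ⟨h1, h2, s, rfl⟩, rfl⟩
    refine ⟨U.max' ⟨s, (hmem s).2 ⟨hsj, hne⟩⟩, (hmem _).1 (U.max'_mem _), fun t h1 h2 => ?_⟩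
    exact U.le_max' _ ((hmem t).2 ⟨h1, h2⟩)
  set M := T.sup (Sum.elim (fun _ => 0) Prod.fst) with hM
  set J := (T.image (Sum.elim (fun _ => 0) Prod.snd)).erase j with hJ
  let q : ℕ → ℂ[X] := fun i => X + C ((r : ℂ) + i)
  let R : ℂ[X] := ∏ i ∈ J, q i ^ M
  let num : ℕ ⊕ ℕ × ℕ → ℂ[X] := Sum.elim (fun f => X ^ f * q j ^ s₀ * R)
    fun sj => if sj.2 = j then q j ^ (s₀ - sj.1) * R
      else q j ^ s₀ * q sj.2 ^ (M - sj.1) * ∏ i ∈ J.erase sj.2, q i ^ M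
  have hq : ∀ i l : ℕ, (q i).eval ((l : ℂ) + 1) ≠ 0 := fun i l => by
    simp only [q, eval_add, eval_X, eval_C]
    exact_mod_cast (by omega : l + 1 + (r + i) ≠ 0)
  have hpole : ∀ (i s l : ℕ), pole (r + i) s l = (((q i).eval ((l : ℂ) + 1)) ^ s)⁻¹ := fun i s l => by
    simp [pole, q]
  have hnum : ∀ w ∈ T, g w ≠ 0 → ∀ l : ℕ,
      (num w).eval ((l : ℂ) + 1) = term r w l * (q j ^ s₀ * R).eval ((l : ℂ) + 1) := by
    rintro (f | ⟨t, i⟩) hw hwg l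
    · simp [num, term, mul_assoc]
    · simp only [num, term, Sum.elim_inr, hpole]
      split_ifs with hij
      · subst hij
        have hts := hmax t hw hwg
        rw [eval_mul, eval_mul, eval_pow, eval_pow, pow_sub₀ _ (hq _ _) hts]
        ring
      · have hiJ : i ∈ J := mem_erase.2 ⟨hij, mem_image.2 ⟨_, hw, rfl⟩⟩
        have htM : t ≤ M := le_sup (f := Sum.elim (fun _ => 0) Prod.fst) hw
        have hR : R = q i ^ M * ∏ i ∈ J.erase i, q i ^ M := (mul_prod_erase _ _ hiJ).symm
        rw [hR, eval_mul, eval_mul, eval_mul, eval_mul, eval_pow, eval_pow, eval_pow,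
          pow_sub₀ _ (hq _ _) htM]
        ring
  have hzero : ∑ w ∈ T, C (g w) * num w = 0 := by
    refine polynomial_eq_zero_of_forall_nat _ fun l => ?_
    rw [eval_finsetSum]
    have : ∀ w ∈ T, (C (g w) * num w).eval ((l : ℂ) + 1) =
        g w * term r w l * (q j ^ s₀ * R).eval ((l : ℂ) + 1) := by
      intro w hw
      rw [eval_mul, eval_C]
      by_cases hwg : g w = 0
      · simp [hwg]
      · rw [hnum w hw hwg, mul_assoc]
    rw [sum_congr rfl this, ← sum_mul, hg, zero_mul]
  have hs₀1 : s₀ ≠ 0 := by have := hT _ hs₀.1 _ _ rfl; omega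
  have hqj : (q j).eval (-((r : ℂ) + j)) = 0 := by simp [q]
  have hR : R.eval (-((r : ℂ) + j)) ≠ 0 := by
    simp only [R, eval_prod, eval_pow]
    refine prod_ne_zero_iff.2 fun i hi => pow_ne_zero _ ?_
    have hij : (i : ℂ) ≠ j := by exact_mod_cast (mem_erase.1 hi).1
    simp only [q, eval_add, eval_X, eval_C]
    rw [show -((r : ℂ) + j) + (r + i) = i - j by ring]
    exact sub_ne_zero.2 hij
  have heval := congrArg (eval (-((r : ℂ) + j))) hzero
  generalize -((r : ℂ) + j) = z at hqj hR heval
  rw [eval_finsetSum, eval_zero, sum_eq_single_of_mem _ hs₀.1] at heval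
  · simp [num, hR, hs₀.2] at heval
  · rintro (f | ⟨t, i⟩) hw hne'
    · simp [num, hqj, hs₀1]
    · by_cases hij : i = j
      · subst hij
        by_cases hgt : g (Sum.inr (t, i)) = 0
        · simp [hgt]
        · have h1 := hmax t hw hgt
          have h2 : s₀ - t ≠ 0 := by
            have : t ≠ s₀ := fun h => hne' (by rw [h])
            omega
          simp [num, hqj, h2]
      · simp [num, hij, hqj, hs₀1]

open Polynomial in
lemma term_independent (r : ℕ) (T : Finset (ℕ ⊕ ℕ × ℕ)) (g : ℕ ⊕ ℕ × ℕ → ℂ)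
    (hT : ∀ w ∈ T, ∀ s j, w = Sum.inr (s, j) → 1 ≤ s)
    (hg : ∀ l, ∑ w ∈ T, g w * term r w l = 0) : ∀ w ∈ T, g w = 0 := by
  have hpole := coeff_pole_eq_zero r T g hT hg
  have hzero : ∑ w ∈ T, C (g w) * Sum.elim (fun f => (X : ℂ[X]) ^ f) 0 w = 0 := by
    refine polynomial_eq_zero_of_forall_nat _ fun l => ?_
    rw [eval_finsetSum, ← hg l]
    refine sum_congr rfl ?_
    rintro (f | ⟨s, j⟩) hw
    · simp [term]
    · simp [hpole s j hw]
  rintro (f | ⟨s, j⟩) hw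
  · have := congrArg (fun Q : ℂ[X] => Q.coeff f) hzero
    simp only [finsetSum_coeff, coeff_zero] at this
    rw [sum_eq_single_of_mem _ hw] at this
    · simpa using this
    · rintro (f' | sj) _ hne
      · have : f ≠ f' := fun h => hne (by rw [h])
        simp [coeff_X_pow, this]
      · simp
  · exact hpole s j hw

/-! ### Depth-`p` coefficients -/

lemma tsum_ev_sub_mem {q : ℕ} {r : Fin (q + 1) → ℕ} {E : Fin (q + 1) → ℤ}
    {c : Fin (q + 1) → ℕ ⊕ ℕ × ℕ →₀ K} (hc : ∀ i, c i ∈ Adm K (E i) {sj | 1 ≤ sj.1})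
    (hF : ∀ i, ev K (r i) (c i) ∈ Cls K (E i)) (hneg : PartialSumsNeg 0 (List.ofFn E))
    {S : Fin (q + 1) → Finset ℕ} (hS : ∀ i, (bar K (c i)).support ⊆ S i)
    (h1 : ∀ i, ∀ s ∈ S i, 1 ≤ s) (h2 : ∀ i : Fin (q + 1), i.1 = 0 → ∀ s ∈ S i, 2 ≤ s) :
    (∑' l : {l : Fin (q + 1) → ℕ // Antitone l}, ∏ i, ev K (r i) (c i) (l.1 i)) -
      ∑ s ∈ Fintype.piFinset S, (∏ i, (bar K (c i) (s i) : ℂ)) * (mzv (List.ofFn s) : ℂ)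
      ∈ mzvSpan K q := by
  obtain ⟨z, hz, hlim⟩ := mem_Conv.1 (nested_ev_sub_nested_lead_mem (limitsInSpan K q) r
    (fun i => q + 1 - 1 - i) E c hc hF hneg)
  have hlim' := (tendsto_nested_ofFn (summable_prod_of_mem_Cls hF hneg)).sub
    (tendsto_nested_lead hS h1 h2)
  rwa [tendsto_nhds_unique hlim' hlim]

lemma bar_apply_eq_sum {e : ℤ} {a n : ℕ} {c : ℕ ⊕ ℕ × ℕ →₀ K}
    (hc : c ∈ Adm K e {sj | 1 ≤ sj.1 ∧ sj.1 ≤ a ∧ sj.2 ≤ n}) (s : ℕ) :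
    bar K c s = ∑ j ∈ Iic n, c (Sum.inr (s, j)) := by
  have h : Finsupp.linearCombination K (fun w => Finsupp.single w (1 : K)) c ∈
      LinearMap.ker ((Finsupp.lapply s).comp (bar K) -
        ∑ j ∈ Iic n, Finsupp.lapply (Sum.inr (s, j))) := by
    refine linearCombination_mem (mem_Adm.1 hc).1 ?_
    rintro (f | ⟨t, j⟩) hw
    · simp [bar]
    · have hj : j ≤ n := hw.2.2
      by_cases hts : t = s <;> simp [bar, Finsupp.single_apply, hts, hj]
  have hcc : Finsupp.linearCombination K (fun w => Finsupp.single w (1 : K)) c = c := by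
    simp [Finsupp.linearCombination_apply]
  rw [hcc, LinearMap.mem_ker, LinearMap.sub_apply, sub_eq_zero] at h
  simpa using h

lemma bar_support_subset {e : ℤ} {a n : ℕ} {c : ℕ ⊕ ℕ × ℕ →₀ K}
    (hc : c ∈ Adm K e {sj | 1 ≤ sj.1 ∧ sj.1 ≤ a ∧ sj.2 ≤ n}) :
    (bar K c).support ⊆ Icc 1 a := by
  have : bar K c ∈ Finsupp.supported K K {s | 1 ≤ s ∧ s ≤ a} := by
    refine linearCombination_mem (mem_Adm.1 hc).1 ?_
    rintro (f | sj) hw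
    · simp
    · exact Finsupp.single_mem_supported _ _ ⟨hw.1, hw.2.1⟩
  exact fun s hs => mem_Icc.2 (this hs)

lemma partialSumsNeg_ofFn {p : ℕ} {E : Fin p → ℤ} {c : ℤ}
    (h : ∀ j, c + ∑ i ∈ Iic j, E i ≤ -1) : PartialSumsNeg c (List.ofFn E) := by
  have hIic : ∀ {m : ℕ} (j : Fin m) (E : Fin m → ℤ),
      ∑ i ∈ Iic j, E i = ∑ i, if i ≤ j then E i else 0 := fun j E => by
    rw [← sum_filter]
    congr 1
    ext i
    simp
  simp only [hIic] at h
  induction p generalizing c with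
  | zero => exact partialSumsNeg_nil c
  | succ p ih =>
    rw [List.ofFn_succ, partialSumsNeg_cons]
    refine ⟨by simpa [Fin.sum_univ_succ] using h 0, ih fun j => ?_⟩
    have := h j.succ
    rw [Fin.sum_univ_succ, if_pos (Fin.zero_le _), ← add_assoc] at this
    simpa using this

lemma ascPochhammer_eval_eq_prod (n : ℕ) (x : ℂ) :
    (ascPochhammer ℂ n).eval x = ∏ j ∈ range n, (x + j) := by
  induction n with
  | zero => simp
  | succ n ih => rw [ascPochhammer_succ_eval, ih, prod_range_succ]

lemma ascPochhammer_eval_ne_zero (n r l : ℕ) :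
    (ascPochhammer ℂ n).eval (((l + 1 : ℕ) : ℂ) + r) ≠ 0 := by
  rw [ascPochhammer_eval_eq_prod]
  exact prod_ne_zero_iff.2 fun j _ => by exact_mod_cast (by omega : l + 1 + r + j ≠ 0)

lemma gen_nsmul_range (r i a n l : ℕ) :
    gen r i (a • Multiset.range n) l =
      ((l + 1 : ℕ) : ℂ) ^ i * (((ascPochhammer ℂ n).eval (((l + 1 : ℕ) : ℂ) + r)) ^ a)⁻¹ := by
  rw [ascPochhammer_eval_eq_prod, gen, Multiset.map_nsmul, Multiset.prod_nsmul]
  push_cast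
  rfl

lemma exists_expansion {e : ℤ} (r i a n : ℕ) (h : (i : ℤ) + 1 ≤ a * (n + 1) + e) :
    ∃ c ∈ Adm K e {sj | 1 ≤ sj.1 ∧ sj.1 ≤ a ∧ sj.2 ≤ n},
      ev K r c = gen r i (a • Multiset.range (n + 1)) := by
  refine gen_mem_map_ev i _ (fun s j hs hsj => ?_) (by simpa using h)
  rw [Multiset.count_nsmul] at hsj
  have hj : j ∈ Multiset.range (n + 1) := by
    by_contra hj
    rw [Multiset.count_eq_zero_of_notMem hj] at hsj
    omega
  rw [Multiset.count_eq_one_of_mem (Multiset.nodup_range _) hj, mul_one] at hsj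
  exact ⟨hs, hsj, Nat.lt_succ_iff.1 (Multiset.mem_range.1 hj)⟩

/-- The shift `l ↦ l + 1` identifies antitone tuples with antitone tuples of positive integers. -/
def antitoneEquivPos (p : ℕ) : {l : Fin p → ℕ // Antitone l} ≃
    {k : Fin p → ℕ // Antitone k ∧ ∀ i, 1 ≤ k i} where
  toFun l := ⟨fun i => l.1 i + 1, fun _ _ hij => Nat.succ_le_succ (l.2 hij), fun _ => by simp⟩
  invFun k := ⟨fun i => k.1 i - 1, fun _ _ hij => Nat.sub_le_sub_right (k.2.1 hij) 1⟩
  left_inv l := by ext i; simp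
  right_inv k := by ext i; exact Nat.sub_add_cancel (k.2.2 i)

lemma Rfun_eq_sum {p : ℕ} (A n r : ℕ → ℕ) (P : MvPolynomial (Fin p) K) (l : Fin p → ℕ) :
    Rfun p K A n r P (fun i => ((l i + 1 : ℕ) : ℂ)) = ∑ α ∈ P.support, ((P.coeff α : K) : ℂ) *
      ∏ i : Fin p, gen (r i) (α i) (A i • Multiset.range (n i + 1)) (l i) := by
  simp only [gen_nsmul_range, prod_mul_distrib, prod_inv_distrib]
  rw [Rfun, MvPolynomial.eval₂_eq', div_eq_mul_inv, sum_mul]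
  exact sum_congr rfl fun α _ => mul_assoc _ _ _

lemma prod_ev_apply {p : ℕ} (r : Fin p → ℕ) (c : Fin p → ℕ ⊕ ℕ × ℕ →₀ K)
    {T : Finset (Fin p → ℕ ⊕ ℕ × ℕ)}
    (hT : (Fintype.piFinset fun i => (c i).support) ⊆ T) (l : Fin p → ℕ) :
    ∏ i, ev K (r i) (c i) (l i) =
      ∑ w ∈ T, ((∏ i, c i (w i) : K) : ℂ) * ∏ i, term (r i) (w i) (l i) := by
  have h : ∀ i, ev K (r i) (c i) (l i) =
      ∑ a ∈ (c i).support, (c i a : ℂ) * term (r i) a (l i) := fun i => by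
    rw [ev, Finsupp.linearCombination_apply, Finsupp.sum, Finset.sum_apply]
    rfl
  simp only [h]
  rw [prod_univ_sum]
  simp only [prod_mul_distrib]
  push_cast
  refine sum_subset hT fun w _ hw => ?_
  rw [Fintype.mem_piFinset] at hw
  push Not at hw
  obtain ⟨i, hi⟩ := hw
  rw [prod_eq_zero (mem_univ i) (by simpa using hi), zero_mul]

lemma pfTerm_eq {p : ℕ} (r : ℕ → ℕ) (w : Fin p → ℕ ⊕ ℕ × ℕ) (l : Fin p → ℕ) :
    pfTerm p r w (fun i => ((l i + 1 : ℕ) : ℂ)) = ∏ i : Fin p, term (r i) (w i) (l i) := by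
  refine prod_congr rfl fun i _ => ?_
  rcases w i with f | sj
  · simp [term]
  · simp [term, pole, add_assoc]

/-- The partial fraction coefficients are determined by the rational function. -/
lemma coeff_eq_sum {p : ℕ} {A n r : ℕ → ℕ} {P : MvPolynomial (Fin p) K}
    {C : (Fin p → ℕ ⊕ ℕ × ℕ) → K} (hCfin : (Function.support C).Finite)
    (hCrange : ∀ w, C w ≠ 0 → ∀ i : Fin p, ∀ s j : ℕ, w i = Sum.inr (s, j) → 1 ≤ s ∧ j ≤ n i.1)
    (hC : ∀ k : Fin p → ℂ,
      (∀ i : Fin p, (ascPochhammer ℂ (n i.1 + 1)).eval (k i + (r i.1 : ℂ)) ≠ 0) →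
      Rfun p K A n r P k = ∑ᶠ w, (C w : ℂ) * pfTerm p r w k)
    {E : (Fin p →₀ ℕ) → Fin p → ℤ} {c : (Fin p →₀ ℕ) → Fin p → ℕ ⊕ ℕ × ℕ →₀ K}
    (hc : ∀ α ∈ P.support, ∀ i, c α i ∈ Adm K (E α i) {sj | 1 ≤ sj.1})
    (hce : ∀ α ∈ P.support, ∀ i : Fin p,
      ev K (r i) (c α i) = gen (r i) (α i) (A i • Multiset.range (n i + 1)))
    (w : Fin p → ℕ ⊕ ℕ × ℕ) : C w = ∑ α ∈ P.support, P.coeff α * ∏ i, c α i (w i) := by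
  classical
  set T := hCfin.toFinset ∪ P.support.biUnion fun α => Fintype.piFinset fun i => (c α i).support
    with hT
  have hsub : ∀ α ∈ P.support, (Fintype.piFinset fun i => (c α i).support) ⊆ T := fun α hα =>
    (subset_biUnion_of_mem (fun α => Fintype.piFinset fun i => (c α i).support) hα).trans
      subset_union_right
  by_cases hw : w ∈ T
  swap
  · have h1 : C w = 0 := by
      by_contra h
      exact hw (mem_union_left _ (hCfin.mem_toFinset.2 h))
    rw [h1, eq_comm]
    refine sum_eq_zero fun α hα => ?_
    have h2 : w ∉ Fintype.piFinset fun i => (c α i).support := fun h => hw (hsub α hα h)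
    rw [Fintype.mem_piFinset] at h2
    push Not at h2
    obtain ⟨i, hi⟩ := h2
    rw [prod_eq_zero (mem_univ i) (by simpa using hi), mul_zero]
  have key := eq_zero_of_sum_prod_eq_zero {w | ∀ s j, w = Sum.inr (s, j) → 1 ≤ s}
    (fun i : Fin p => term (r i)) (fun i T g hT hg => term_independent (r i) T g hT hg) T
    (fun w => ((C w - ∑ α ∈ P.support, P.coeff α * ∏ i, c α i (w i) : K) : ℂ)) ?_ ?_ w hw
  · exact sub_eq_zero.1 (by exact_mod_cast key)
  · intro u hu i s j hus
    rcases mem_union.1 hu with h | h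
    · exact (hCrange u (hCfin.mem_toFinset.1 h) i s j hus).1
    · obtain ⟨α, hα, h⟩ := mem_biUnion.1 h
      have := (mem_Adm.1 (hc α hα i)).1 (Fintype.mem_piFinset.1 h i)
      rw [hus] at this
      exact this
  · intro l
    have h1 := hC (fun i => ((l i + 1 : ℕ) : ℂ)) fun i => ascPochhammer_eval_ne_zero _ _ _
    rw [finsum_eq_sum_of_support_subset (s := T) _ ?_, Rfun_eq_sum] at h1
    · simp only [pfTerm_eq] at h1
      have h2 : ∀ α ∈ P.support, ((P.coeff α : K) : ℂ) *
          ∏ i : Fin p, gen (r i) (α i) (A i • Multiset.range (n i + 1)) (l i) =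
          ∑ w ∈ T, ((P.coeff α : K) : ℂ) * (((∏ i, c α i (w i) : K) : ℂ) *
            ∏ i : Fin p, term (r i) (w i) (l i)) := fun α hα => by
        rw [← mul_sum, ← prod_ev_apply (fun i : Fin p => r i) (c α) (hsub α hα)]
        exact congrArg _ (prod_congr rfl fun i _ => by rw [hce α hα i])
      rw [sum_congr rfl h2, sum_comm, eq_comm, ← sub_eq_zero, ← sum_sub_distrib] at h1
      rw [← h1]
      refine sum_congr rfl fun w _ => ?_
      push_cast
      rw [sub_mul, sum_mul]
      simp only [mul_assoc]
    · intro w hw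
      refine mem_coe.2 (mem_union_left _ (hCfin.mem_toFinset.2 fun h => hw ?_))
      simp [h]

/-- Elements of `mzvSpan` are explicit finite combinations of multiple zeta values. -/
lemma exists_eq_sum_of_mem_mzvSpan {q : ℕ} {z : ℂ} (hz : z ∈ mzvSpan K q) :
    ∃ (T : Finset (List ℕ)) (c : List ℕ → K),
      (∀ s ∈ T, s.length < q + 1 ∧ (∀ a ∈ s, 1 ≤ a) ∧ (s ≠ [] → 2 ≤ s.headI)) ∧
      z = ∑ s ∈ T, (c s : ℂ) * (mzv s : ℂ) := by
  obtain ⟨c, hc, rfl⟩ := (Finsupp.mem_span_image_iff_linearCombination K).1 hz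
  refine ⟨c.support, c, fun s hs => ?_, rfl⟩
  have := hc hs
  exact ⟨Nat.lt_succ_iff.2 this.1, this.2⟩

end NestedSum

open NestedSum Finset in
theorem statement5 (p : ℕ) (hp : 0 < p) (A n r : ℕ → ℕ) (K : Subfield ℂ)
    (P : MvPolynomial (Fin p) K)
    (h9 : ∀ j : Fin p, (∑ i ∈ Finset.Iic j, P.degreeOf i) + j.1 + 2 ≤
      ∑ i ∈ Finset.Iic j, A i.1 * (n i.1 + 1))
    (C : (Fin p → ℕ ⊕ ℕ × ℕ) → K)
    (hCfin : (Function.support C).Finite)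
    (hCrange : ∀ w, C w ≠ 0 → ∀ i : Fin p, ∀ s j : ℕ,
      w i = Sum.inr (s, j) → 1 ≤ s ∧ j ≤ n i.1)
    (hC : ∀ k : Fin p → ℂ,
      (∀ i : Fin p, (ascPochhammer ℂ (n i.1 + 1)).eval (k i + (r i.1 : ℂ)) ≠ 0) →
      Rfun p K A n r P k = ∑ᶠ w, (C w : ℂ) * pfTerm p r w k) :
    Summable (fun k : {k : Fin p → ℕ // Antitone k ∧ ∀ i, 1 ≤ k i} =>
        Rfun p K A n r P (fun i => (k.1 i : ℂ))) ∧
    ∃ (T : Finset (List ℕ)) (c : List ℕ → K),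
      (∀ s ∈ T, s.length < p ∧ (∀ a ∈ s, 1 ≤ a) ∧ (s ≠ [] → 2 ≤ s.headI)) ∧
      (∑' k : {k : Fin p → ℕ // Antitone k ∧ ∀ i, 1 ≤ k i},
          Rfun p K A n r P (fun i => (k.1 i : ℂ)))
        = (∑ s ∈ T, (c s : ℂ) * (mzv s : ℂ)) +
          ∑ s ∈ (Fintype.piFinset fun i : Fin p => Finset.Icc 1 (A i.1)).filter
              (fun s => 2 ≤ s ⟨0, hp⟩),
            (((∑ j ∈ Fintype.piFinset fun i : Fin p => Finset.Iic (n i.1),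
                C fun i => Sum.inr (s i, j i)) : K) : ℂ) * (mzv (List.ofFn s) : ℂ) := by
  obtain ⟨q, rfl⟩ : ∃ q, p = q + 1 := ⟨p - 1, by omega⟩
  -- each monomial of `P` contributes a product of one-variable functions
  let E : (Fin (q + 1) →₀ ℕ) → Fin (q + 1) → ℤ := fun α i => α i - A i * (n i + 1) + 1
  have hexp : ∀ (α : Fin (q + 1) →₀ ℕ) (i : Fin (q + 1)), _ := fun α i =>
    exists_expansion (K := K) (e := E α i) (r i) (α i) (A i) (n i) (by simp only [E]; omega)
  choose c hcB hce using hexp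
  have hc : ∀ α i, c α i ∈ Adm K (E α i) {sj | 1 ≤ sj.1} := fun α i =>
    Adm_mono (fun sj h => h.1) (hcB α i)
  have hF : ∀ α i, ev K (r i) (c α i) ∈ Cls K (E α i) := fun α i => by
    rw [hce]
    refine gen_mem_Cls _ _ _ ?_
    simp only [Multiset.card_nsmul, Multiset.card_range, E]
    push_cast
    linarith
  have hneg : ∀ α ∈ P.support, PartialSumsNeg 0 (List.ofFn (E α)) := fun α hα => by
    refine partialSumsNeg_ofFn fun j => ?_
    have h1 : ∑ i ∈ Iic j, α i ≤ ∑ i ∈ Iic j, P.degreeOf i :=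
      sum_le_sum fun i _ => MvPolynomial.monomial_le_degreeOf i hα
    have h2 : ((∑ i ∈ Iic j, α i : ℕ) : ℤ) + j.1 + 2 ≤
        ((∑ i ∈ Iic j, A i.1 * (n i.1 + 1) : ℕ) : ℤ) := by
      have := h9 j
      omega
    push_cast at h2
    simp only [E, sum_add_distrib, sum_sub_distrib, sum_const, Fin.card_Iic]
    simp only [nsmul_eq_mul, mul_one]
    push_cast
    linarith
  have hsum : ∀ α ∈ P.support, Summable fun l : {l : Fin (q + 1) → ℕ // Antitone l} =>
      ∏ i : Fin (q + 1), ev K (r i) (c α i) (l.1 i) := fun α hα => summable_prod_of_mem_Cls (hF α) (hneg α hα)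
  have hR : ∀ l : {l : Fin (q + 1) → ℕ // Antitone l},
      Rfun (q + 1) K A n r P (fun i => ((antitoneEquivPos (q + 1) l).1 i : ℂ)) =
        ∑ α ∈ P.support, ((P.coeff α : K) : ℂ) * ∏ i : Fin (q + 1), ev K (r i) (c α i) (l.1 i) := fun l => by
    simp only [hce]
    exact Rfun_eq_sum A n r P l.1
  refine ⟨?_, ?_⟩
  · rw [← (antitoneEquivPos (q + 1)).summable_iff]
    refine Summable.congr (summable_sum fun α hα => (hsum α hα).mul_left ((P.coeff α : K) : ℂ))
      fun l => (hR l).symm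
  rw [← (antitoneEquivPos (q + 1)).tsum_eq, tsum_congr hR,
    Summable.tsum_finsetSum fun α hα => (hsum α hα).mul_left _]
  simp only [tsum_mul_left]
  -- the exponents of the multiple zeta values of depth `q + 1`
  let S : Fin (q + 1) → Finset ℕ := fun i => Icc (if i.1 = 0 then 2 else 1) (A i)
  have hpi : (Fintype.piFinset fun i : Fin (q + 1) => Icc 1 (A i.1)).filter
      (fun s => 2 ≤ s ⟨0, hp⟩) = Fintype.piFinset S := by
    ext s
    simp only [mem_filter, Fintype.mem_piFinset, mem_Icc, S]
    constructor
    · rintro ⟨h1, h2⟩ i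
      refine ⟨?_, (h1 i).2⟩
      split_ifs with hi
      · rwa [show i = ⟨0, hp⟩ from Fin.ext hi]
      · exact (h1 i).1
    · refine fun h => ⟨fun i => ⟨?_, (h i).2⟩, by simpa using (h ⟨0, hp⟩).1⟩
      have := (h i).1
      split_ifs at this <;> omega
  have hlead : ∀ α ∈ P.support,
      (∑' l : {l : Fin (q + 1) → ℕ // Antitone l}, ∏ i : Fin (q + 1), ev K (r i) (c α i) (l.1 i)) -
      ∑ s ∈ Fintype.piFinset S, (∏ i, (bar K (c α i) (s i) : ℂ)) * (mzv (List.ofFn s) : ℂ)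
      ∈ mzvSpan K q := fun α hα => by
    refine tsum_ev_sub_mem (hc α) (hF α) (hneg α hα) (fun i s hs => ?_) (fun i s hs => ?_)
      fun i hi s hs => ?_
    · have h1 := mem_Icc.1 (bar_support_subset (hcB α i) hs)
      refine mem_Icc.2 ⟨?_, h1.2⟩
      split_ifs with hi
      · exact bar_mem_supported_two (hc α i) ((hneg α hα).head_le i hi) hs
      · exact h1.1
    · have := (mem_Icc.1 hs).1
      split_ifs at this <;> omega
    · simpa [S, hi] using (mem_Icc.1 hs).1
  have hcoeff : ∀ s : Fin (q + 1) → ℕ,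
      (∑ j ∈ Fintype.piFinset fun i : Fin (q + 1) => Iic (n i.1), C fun i => Sum.inr (s i, j i)) =
        ∑ α ∈ P.support, P.coeff α * ∏ i, bar K (c α i) (s i) := fun s => by
    simp only [coeff_eq_sum hCfin hCrange hC (fun α _ => hc α) fun α _ => hce α]
    rw [sum_comm]
    refine sum_congr rfl fun α _ => ?_
    simp only [← mul_sum, bar_apply_eq_sum (hcB α _)]
    rw [prod_univ_sum]
  obtain ⟨T, d, hT, hd⟩ := exists_eq_sum_of_mem_mzvSpan
    (Submodule.sum_mem _ fun α hα => Submodule.smul_mem _ (P.coeff α) (hlead α hα))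
  refine ⟨T, d, hT, ?_⟩
  rw [← hd, hpi]
  simp only [hcoeff, Subfield.smul_def, smul_eq_mul, mul_sub, sum_sub_distrib]
  push_cast
  simp only [sum_mul, mul_sum]
  rw [sum_comm (s := Fintype.piFinset S)]
  simp only [mul_assoc, sub_add_cancel]
end

section
/- Assume deg_{k_1} P ≤ A_1(n_1+1) − 2. Then for all integers s_2, …, s_p ≥ 1 and all j_2, …, j_p with 0 ≤ j_i ≤ n_i, one has Σ_{j_1=0}^{n_1} C[∅, ∅, (1, s_2, …, s_p), (j_1, j_2, …, j_p)] = 0. -/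
open Filter Topology Bornology

/-- The one-variable factor of an elementary term: a monomial or a polar factor. -/
noncomputable def pfFactor (r : ℕ) (a : ℕ ⊕ ℕ × ℕ) (z : ℂ) : ℂ :=
  Sum.elim (fun f : ℕ => z ^ f)
    (fun sj : ℕ × ℕ => ((z + (r : ℂ) + (sj.2 : ℂ)) ^ sj.1)⁻¹) a

/-- The indices whose pole order, if any, is positive. -/
def pfIndices : Set (ℕ ⊕ ℕ × ℕ) := {a | ∀ s j, a = Sum.inr (s, j) → 1 ≤ s}

/-- The complex numbers that are not non-positive integers. -/
def regularPoints : Set ℂ := {z | ∀ m : ℕ, z + m ≠ 0}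

theorem ascPochhammer_eval_eq_prod (n : ℕ) (z : ℂ) :
    (ascPochhammer ℂ n).eval z = ∏ j ∈ Finset.range n, (z + j) := by
  induction n with
  | zero => simp
  | succ n ih => rw [ascPochhammer_succ_eval, ih, Finset.prod_range_succ]

theorem tendsto_inv_add_const_cobounded (a : ℂ) :
    Tendsto (fun z : ℂ => (z + a)⁻¹) (cobounded ℂ) (𝓝 0) :=
  tendsto_inv₀_cobounded.comp (tendsto_add_const_cobounded a)

theorem eventually_ne_cobounded_complex (a : ℂ) : ∀ᶠ z in cobounded ℂ, z ≠ a := by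
  have : ({a} : Set ℂ)ᶜ ∈ cobounded ℂ := by
    rw [← Bornology.isBounded_def]
    exact Bornology.isBounded_singleton
  exact this

theorem tendsto_mul_inv_add_const_cobounded (a : ℂ) :
    Tendsto (fun z : ℂ => z * (z + a)⁻¹) (cobounded ℂ) (𝓝 1) := by
  have h := (tendsto_inv_add_const_cobounded a).const_mul a |>.const_sub 1
  simp only [mul_zero, sub_zero] at h
  refine h.congr' ?_
  filter_upwards [eventually_ne_cobounded_complex (-a)] with z hz
  have : z + a ≠ 0 := fun h => hz (eq_neg_of_add_eq_zero_left h)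
  field_simp
  ring

/-- A combination of elementary factors that vanishes at infinity has no polynomial part. -/
theorem coeff_inl_eq_zero_of_tendsto {l : Filter ℂ} [l.NeBot] (hl : l ≤ cobounded ℂ) (r : ℕ)
    (S : Finset (ℕ ⊕ ℕ × ℕ)) (hS : ↑S ⊆ pfIndices) (c : ℕ ⊕ ℕ × ℕ → ℂ)
    (h : Tendsto (fun z => ∑ a ∈ S, c a * pfFactor r a z) l (𝓝 0)) (f : ℕ)
    (hf : Sum.inl f ∈ S) : c (Sum.inl f) = 0 := by
  by_contra hne
  let F : Finset ℕ := S.toLeft.filter fun f => c (Sum.inl f) ≠ 0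
  have hF : F.Nonempty := ⟨f, by simp [F, hf, hne]⟩
  obtain ⟨g, hgF, hmax⟩ := F.exists_max_image id hF
  simp only [F, Finset.mem_filter, Finset.mem_toLeft, id] at hgF hmax
  have hinv : Tendsto (fun z : ℂ => z⁻¹) l (𝓝 0) := tendsto_inv₀_cobounded.mono_left hl
  have h0 : Tendsto (fun z => (∑ a ∈ S, c a * pfFactor r a z) * z⁻¹ ^ g) l (𝓝 0) := by
    simpa using h.mul (hinv.pow g)
  have h1 : Tendsto (fun z => ∑ a ∈ S, c a * pfFactor r a z * z⁻¹ ^ g) l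
      (𝓝 (∑ a ∈ S, if a = Sum.inl g then c a else 0)) := by
    refine tendsto_finsetSum _ fun a ha => ?_
    rcases a with k | ⟨s, j⟩
    · rcases lt_trichotomy k g with hk | rfl | hk
      · have : Tendsto (fun z : ℂ => c (Sum.inl k) * z⁻¹ ^ (g - k)) l (𝓝 0) := by
          simpa [(Nat.sub_pos_of_lt hk).ne'] using (hinv.pow (g - k)).const_mul (c (Sum.inl k))
        simp only [Sum.inl.injEq, hk.ne, if_false]
        refine this.congr' ?_
        filter_upwards [hl (eventually_ne_cobounded_complex 0)] with z hz
        obtain ⟨d, rfl⟩ := Nat.exists_eq_add_of_lt hk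
        have hd : k + d + 1 - k = d + 1 := by omega
        rw [hd, add_assoc k, pow_add _ k]
        simp only [pfFactor, Sum.elim_inl, inv_pow]
        field_simp
      · simp only [if_true]
        refine tendsto_const_nhds.congr' ?_
        filter_upwards [hl (eventually_ne_cobounded_complex 0)] with z hz
        simp only [pfFactor, Sum.elim_inl, inv_pow]
        field_simp
      · have hc : c (Sum.inl k) = 0 := by
          by_contra hc
          exact absurd (hmax k ⟨ha, hc⟩) (by omega)
        simp [hc]
    · have hs : 1 ≤ s := hS ha s j rfl
      have := (((tendsto_inv_add_const_cobounded (r + j)).mono_left hl).pow s).mul (hinv.pow g)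
        |>.const_mul (c (Sum.inr (s, j)))
      simpa [pfFactor, (Nat.one_le_iff_ne_zero.mp hs), add_assoc, mul_assoc] using this
  simp only [Finset.sum_mul] at h0
  have := tendsto_nhds_unique h1 h0
  rw [Finset.sum_ite_eq' S, if_pos hgF.1] at this
  exact hgF.2 this

open Classical in
/-- A combination of elementary factors that is `o(1/z)` at infinity has residue sum zero. -/
theorem sum_residues_eq_zero_of_tendsto {l : Filter ℂ} [l.NeBot] (hl : l ≤ cobounded ℂ) (r : ℕ)
    (S : Finset (ℕ ⊕ ℕ × ℕ)) (hS : ↑S ⊆ pfIndices) (c : ℕ ⊕ ℕ × ℕ → ℂ)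
    (h : Tendsto (fun z => (∑ a ∈ S, c a * pfFactor r a z) * z) l (𝓝 0)) :
    ∑ a ∈ S with (∃ j, a = Sum.inr (1, j)), c a = 0 := by
  have hinv : Tendsto (fun z : ℂ => z⁻¹) l (𝓝 0) := tendsto_inv₀_cobounded.mono_left hl
  have hz : Tendsto (fun z => ∑ a ∈ S, c a * pfFactor r a z) l (𝓝 0) := by
    have := h.mul hinv
    rw [mul_zero] at this
    refine this.congr' ?_
    filter_upwards [hl (eventually_ne_cobounded_complex 0)] with z hz
    field_simp
  have h1 : Tendsto (fun z => ∑ a ∈ S, c a * pfFactor r a z * z) l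
      (𝓝 (∑ a ∈ S, if (∃ j, a = Sum.inr (1, j)) then c a else 0)) := by
    refine tendsto_finsetSum _ fun a ha => ?_
    rcases a with k | ⟨s, j⟩
    · simp [coeff_inl_eq_zero_of_tendsto hl r S hS c hz k ha]
    · have hs : 1 ≤ s := hS ha s j rfl
      obtain ⟨s, rfl⟩ := Nat.exists_eq_add_of_le' hs
      have := (((tendsto_inv_add_const_cobounded (r + j)).mono_left hl).pow s).mul
        ((tendsto_mul_inv_add_const_cobounded (r + j)).mono_left hl)
        |>.const_mul (c (Sum.inr (s + 1, j)))
      convert this using 2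
      · simp only [pfFactor, Sum.elim_inr, ← inv_pow, add_assoc]
        ring
      · rcases s with _ | s <;> simp
  simp only [Finset.sum_mul] at h
  rw [Finset.sum_filter]
  exact tendsto_nhds_unique h1 h

theorem eventually_regularPoints_map_natCast :
    ∀ᶠ z in map (fun N : ℕ => (N : ℂ)) atTop, z ∈ regularPoints := by
  rw [eventually_map]
  filter_upwards [eventually_ge_atTop 1] with N hN m
  exact_mod_cast (by omega : N + m ≠ 0)

theorem eventually_regularPoints_nhdsNE (z₀ : ℂ) :
    ∀ᶠ z in 𝓝[≠] z₀, z ∈ regularPoints := by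
  obtain ⟨M, hM⟩ := exists_nat_gt (‖z₀‖ + 1)
  have hsmall : ∀ᶠ z in 𝓝[≠] z₀, ∀ m ∈ Finset.range M, z + (m : ℂ) ≠ 0 := by
    rw [Filter.eventually_all_finset]
    intro m _
    by_cases h : z₀ + m = 0
    · filter_upwards [self_mem_nhdsWithin] with z hz hzm
      exact hz (add_right_cancel (hzm.trans h.symm))
    · have : Continuous fun z : ℂ => z + m := by fun_prop
      exact nhdsWithin_le_nhds (this.continuousAt.eventually_ne h)
  have hnorm : ∀ᶠ z in 𝓝[≠] z₀, ‖z‖ < ‖z₀‖ + 1 :=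
    nhdsWithin_le_nhds (continuous_norm.continuousAt.eventually_lt_const (lt_add_one _))
  filter_upwards [hsmall, hnorm] with z h1 h2 m
  by_cases hm : m < M
  · exact h1 m (Finset.mem_range.mpr hm)
  · intro h
    have hz : ‖z‖ = m := by rw [eq_neg_of_add_eq_zero_left h, norm_neg, Complex.norm_natCast]
    have : (M : ℝ) ≤ m := by exact_mod_cast not_lt.mp hm
    linarith

instance : Nonempty regularPoints :=
  ⟨⟨1, fun m => by exact_mod_cast (by omega : 1 + m ≠ 0)⟩⟩

theorem linearIndepOn_pfFactor (r : ℕ) :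
    LinearIndepOn ℂ (fun a (z : regularPoints) => pfFactor r a z) pfIndices := by
  classical
  rw [linearIndepOn_iff']
  intro S c hS hsum
  have hsum' : ∀ z ∈ regularPoints, ∑ a ∈ S, c a * pfFactor r a z = 0 := fun z hz => by
    simpa using congrFun hsum ⟨z, hz⟩
  rintro (f | ⟨s, j⟩) ha
  · refine coeff_inl_eq_zero_of_tendsto (l := map (fun N : ℕ => (N : ℂ)) atTop)
      tendsto_natCast_atTop_cobounded r S hS c ?_ f ha
    refine tendsto_const_nhds.congr' ?_
    filter_upwards [eventually_regularPoints_map_natCast] with z hz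
    exact (hsum' z hz).symm
  · by_contra hne
    let F : Finset ℕ := (S.image fun a => Sum.elim 0 Prod.fst a).filter
      fun s => Sum.inr (s, j) ∈ S ∧ c (Sum.inr (s, j)) ≠ 0
    have hF : F.Nonempty := ⟨s, by
      simp only [F, Finset.mem_filter, Finset.mem_image]
      exact ⟨⟨_, ha, rfl⟩, ha, hne⟩⟩
    obtain ⟨g, hgF, hmax⟩ := F.exists_max_image id hF
    have hmax' : ∀ s, Sum.inr (s, j) ∈ S → c (Sum.inr (s, j)) ≠ 0 → s ≤ g := fun s h1 h2 =>
      hmax s (by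
        simp only [F, Finset.mem_filter, Finset.mem_image]
        exact ⟨⟨_, h1, rfl⟩, h1, h2⟩)
    replace hgF := (Finset.mem_filter.mp hgF).2
    have hg : 1 ≤ g := hS hgF.1 g j rfl
    let z₀ : ℂ := -(r + j)
    have hw : Tendsto (fun z : ℂ => z + r + j) (𝓝[≠] z₀) (𝓝 0) := by
      have : Continuous fun z : ℂ => z + r + j := by fun_prop
      have h := (this.tendsto z₀).mono_left (nhdsWithin_le_nhds (s := {z₀}ᶜ))
      simpa [z₀, add_assoc] using h
    have hw0 : ∀ᶠ z : ℂ in 𝓝[≠] z₀, z + r + j ≠ 0 := by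
      filter_upwards [self_mem_nhdsWithin] with z hz h
      exact hz (eq_neg_of_add_eq_zero_left (by rw [← h, add_assoc]))
    have h0 : Tendsto (fun z => ∑ a ∈ S, c a * pfFactor r a z * (z + r + j) ^ g)
        (𝓝[≠] z₀) (𝓝 0) := by
      refine tendsto_const_nhds.congr' ?_
      filter_upwards [eventually_regularPoints_nhdsNE z₀] with z hz
      rw [← Finset.sum_mul, hsum' z hz, zero_mul]
    have h1 : Tendsto (fun z => ∑ a ∈ S, c a * pfFactor r a z * (z + r + j) ^ g) (𝓝[≠] z₀)
        (𝓝 (∑ a ∈ S, if a = Sum.inr (g, j) then c a else 0)) := by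
      refine tendsto_finsetSum _ fun a haS => ?_
      have hreg : ∀ a, ContinuousAt (pfFactor r a) z₀ →
          Tendsto (fun z => c a * pfFactor r a z * (z + r + j) ^ g) (𝓝[≠] z₀) (𝓝 0) := by
        intro a ha
        have := (((ha.tendsto).mono_left nhdsWithin_le_nhds).const_mul (c a)).mul (hw.pow g)
        simpa [Nat.one_le_iff_ne_zero.mp hg] using this
      rcases a with k | ⟨s, i⟩
      · simp only [reduceCtorEq, if_false]
        refine hreg _ ?_
        unfold pfFactor
        simp only [Sum.elim_inl]
        fun_prop
      · by_cases hij : i = j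
        · subst hij
          rcases lt_trichotomy s g with hs | hs | hs
          · simp only [Sum.inr.injEq, Prod.mk.injEq, hs.ne, false_and, if_false]
            have := (hw.pow (g - s)).const_mul (c (Sum.inr (s, i)))
            rw [zero_pow (Nat.sub_pos_of_lt hs).ne', mul_zero] at this
            refine this.congr' ?_
            filter_upwards [hw0] with z hz
            obtain ⟨d, rfl⟩ := Nat.exists_eq_add_of_lt hs
            have hd : s + d + 1 - s = d + 1 := by omega
            rw [hd, add_assoc s, pow_add _ s]
            simp only [pfFactor, Sum.elim_inr]
            field_simp
          · subst hs
            simp only [if_true]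
            refine tendsto_const_nhds.congr' ?_
            filter_upwards [hw0] with z hz
            simp only [pfFactor, Sum.elim_inr]
            field_simp
          · have hc : c (Sum.inr (s, i)) = 0 := by
              by_contra hc
              exact absurd (hmax' s haS hc) (by omega)
            simp [hc]
        · simp only [Sum.inr.injEq, Prod.mk.injEq, hij, and_false, if_false]
          refine hreg _ ?_
          unfold pfFactor
          simp only [Sum.elim_inr]
          refine ContinuousAt.inv₀ (by fun_prop) (pow_ne_zero _ ?_)
          intro h
          have : (i : ℂ) = j := by
            simp only [z₀] at h
            linear_combination h
          exact hij (by exact_mod_cast this)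
    have := tendsto_nhds_unique h1 h0
    rw [Finset.sum_ite_eq' S, if_pos hgF.1] at this
    exact hgF.2 this

/-- Separation of variables: products of linearly independent families in independent variables
may be separated in any set `T` of variables. -/
theorem sum_filter_eq_zero_of_linearIndepOn {σ ι X : Type*} [Nonempty X] [DecidableEq σ] [DecidableEq ι]
    (e : σ → ι → X → ℂ) (V : Set ι) (T : Finset σ)
    (he : ∀ i ∈ T, LinearIndepOn ℂ (e i) V) (C : (σ → ι) → ℂ) (u : σ → ι)
    (W : Finset (σ → ι)) (hW : ∀ w ∈ W, ∀ i ∈ T, w i ∈ V)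
    (h : ∀ x : σ → X, ∑ w ∈ W, C w * ∏ i ∈ T, e i (w i) (x i) = 0) :
    ∑ w ∈ W with (∀ i ∈ T, w i = u i), C w = 0 := by
  induction T using Finset.induction_on generalizing W with
  | empty =>
    simpa using h fun _ => Classical.arbitrary X
  | insert i T hi ih =>
    have key : ∀ x : σ → X,
        ∑ w ∈ W with w i = u i, C w * ∏ k ∈ T, e k (w k) (x k) = 0 := by
      intro x
      by_cases hu : u i ∈ W.image (· i)
      swap
      · refine Finset.sum_eq_zero fun w hw => ?_
        rw [Finset.mem_filter] at hw
        exact absurd (Finset.mem_image.mpr ⟨w, hw⟩) hu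
      refine linearIndepOn_iff'.mp (he i (Finset.mem_insert_self i T)) (W.image (· i))
        (fun a => ∑ w ∈ W with w i = a, C w * ∏ k ∈ T, e k (w k) (x k)) ?_ ?_ (u i) hu
      · intro a ha
        obtain ⟨w, hw, rfl⟩ := Finset.mem_image.mp (Finset.mem_coe.mp ha)
        exact hW w hw i (Finset.mem_insert_self i T)
      · funext t
        have ht := h (Function.update x i t)
        rw [← Finset.sum_fiberwise_of_maps_to
          (fun w hw => Finset.mem_image_of_mem (· i) hw)] at ht
        simp only [Finset.sum_apply, Pi.smul_apply, smul_eq_mul, Pi.zero_apply]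
        rw [← ht]
        refine Finset.sum_congr rfl fun a _ => ?_
        rw [Finset.sum_mul]
        refine Finset.sum_congr rfl fun w hw => ?_
        rw [Finset.prod_insert hi, Function.update_self, (Finset.mem_filter.mp hw).2]
        have : ∏ k ∈ T, e k (w k) (Function.update x i t k) = ∏ k ∈ T, e k (w k) (x k) :=
          Finset.prod_congr rfl fun k hk => by
            rw [Function.update_of_ne (ne_of_mem_of_not_mem hk hi)]
        rw [this]
        ring
    have := ih (fun k hk => he k (Finset.mem_insert_of_mem hk)) _
      (fun w hw k hk => hW w (Finset.mem_filter.mp hw).1 k (Finset.mem_insert_of_mem hk)) key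
    simpa only [Finset.filter_filter, Finset.forall_mem_insert] using this

/-- In one variable, a quotient by a power of a Pochhammer symbol is `o(1/z)` at infinity as soon
as the degree of the denominator exceeds that of the numerator by at least two. -/
theorem tendsto_pow_div_ascPochhammer (A n r d : ℕ) (hd : d + 2 ≤ A * (n + 1)) :
    Tendsto (fun z : ℂ => z ^ d / (ascPochhammer ℂ (n + 1)).eval (z + r) ^ A * z)
      (cobounded ℂ) (𝓝 0) := by
  obtain ⟨m, hm⟩ := Nat.exists_eq_add_of_le hd
  have h1 : Tendsto (fun z : ℂ => (∏ j ∈ Finset.range (n + 1), z * (z + (r + j))⁻¹) ^ A)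
      (cobounded ℂ) (𝓝 1) := by
    have := (tendsto_finsetProd (Finset.range (n + 1)) fun j _ =>
      tendsto_mul_inv_add_const_cobounded (r + j)).pow A
    simpa using this
  have h2 := h1.mul ((tendsto_inv₀_cobounded (α := ℂ)).pow (m + 1))
  rw [zero_pow (Nat.succ_ne_zero m), mul_zero] at h2
  refine h2.congr' ?_
  filter_upwards [eventually_ne_cobounded_complex 0] with z hz
  rw [ascPochhammer_eval_eq_prod, Finset.prod_mul_distrib, mul_pow, Finset.prod_const,
    Finset.card_range, ← pow_mul, mul_comm (n + 1) A, hm, Finset.prod_inv_distrib]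
  simp only [add_assoc, div_eq_mul_inv, inv_pow]
  have : z ^ (d + (2 + m)) = z ^ d * z * z ^ (m + 1) := by ring
  rw [this]
  field_simp

theorem tendsto_eval₂_update_div_ascPochhammer {σ : Type*} [Fintype σ] [DecidableEq σ]
    (K : Subfield ℂ) (P : MvPolynomial σ K) (i : σ) (A n r : ℕ)
    (hdeg : P.degreeOf i + 2 ≤ A * (n + 1)) (x : σ → ℂ) :
    Tendsto (fun z : ℂ => MvPolynomial.eval₂ K.subtype (Function.update x i z) P /
      (ascPochhammer ℂ (n + 1)).eval (z + r) ^ A * z) (cobounded ℂ) (𝓝 0) := by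
  simp only [MvPolynomial.eval₂_eq', Finset.sum_div, Finset.sum_mul]
  rw [← Finset.sum_const_zero (s := P.support)]
  refine tendsto_finsetSum _ fun m hm => ?_
  have := (tendsto_pow_div_ascPochhammer A n r (m i)
    (le_trans (by have := MvPolynomial.monomial_le_degreeOf i hm; omega) hdeg)).const_mul
    (K.subtype (P.coeff m) * ∏ k ∈ Finset.univ.erase i, x k ^ m k)
  rw [mul_zero] at this
  refine this.congr fun z => ?_
  rw [← Finset.mul_prod_erase Finset.univ _ (Finset.mem_univ i), Function.update_self]
  have : ∏ k ∈ Finset.univ.erase i, Function.update x i z k ^ m k =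
      ∏ k ∈ Finset.univ.erase i, x k ^ m k :=
    Finset.prod_congr rfl fun k hk => by rw [Function.update_of_ne (Finset.ne_of_mem_erase hk)]
  rw [this]
  ring

theorem ascPochhammer_eval_ne_zero_of_mem_regularPoints {z : ℂ} (hz : z ∈ regularPoints)
    (n r : ℕ) : (ascPochhammer ℂ n).eval (z + r) ≠ 0 := by
  rw [ascPochhammer_eval_eq_prod]
  refine Finset.prod_ne_zero_iff.mpr fun j _ => ?_
  simpa [add_assoc] using hz (r + j)

theorem statement6 (p : ℕ) (hp : 0 < p) (A n r : ℕ → ℕ) (K : Subfield ℂ)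
    (P : MvPolynomial (Fin p) K)
    (hdeg : P.degreeOf (⟨0, hp⟩ : Fin p) + 2 ≤ A 0 * (n 0 + 1))
    (C : (Fin p → ℕ ⊕ ℕ × ℕ) → K)
    (hCfin : (Function.support C).Finite)
    (hCrange : ∀ w, C w ≠ 0 → ∀ i : Fin p, ∀ s j : ℕ,
      w i = Sum.inr (s, j) → 1 ≤ s ∧ j ≤ n i.1)
    (hC : ∀ k : Fin p → ℂ,
      (∀ i : Fin p, (ascPochhammer ℂ (n i.1 + 1)).eval (k i + (r i.1 : ℂ)) ≠ 0) →
      MvPolynomial.eval₂ K.subtype k P /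
          ∏ i : Fin p, ((ascPochhammer ℂ (n i.1 + 1)).eval (k i + (r i.1 : ℂ))) ^ A i.1
        = ∑ᶠ w, (C w : ℂ) * pfTerm p r w k) :
    ∀ s j : Fin p → ℕ, (∀ i : Fin p, i.1 ≠ 0 → 1 ≤ s i) →
      (∀ i : Fin p, j i ≤ n i.1) →
      ∑ j1 ∈ Finset.Iic (n 0),
        C (fun i => Sum.inr (if i.1 = 0 then (1, j1) else (s i, j i))) = 0 := by
  classical
  intro s j hs hj
  let i₀ : Fin p := ⟨0, hp⟩
  let W := hCfin.toFinset
  have hWV : ∀ w ∈ W, ∀ i, w i ∈ pfIndices := fun w hw i s j h =>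
    (hCrange w (by simpa [W] using hw) i s j h).1
  have hval : ∀ i : Fin p, i.1 = 0 ↔ i = i₀ := fun i => by simp [i₀, Fin.ext_iff]
  have hsep : ∀ x : Fin p → regularPoints,
      ∑ w ∈ W with (∃ j, w i₀ = Sum.inr (1, j)),
        (C w : ℂ) * ∏ i ∈ Finset.univ.erase i₀, pfFactor (r i) (w i) (x i) = 0 := by
    intro x
    let D : ℂ := ∏ i ∈ Finset.univ.erase i₀,
      ((ascPochhammer ℂ (n i.1 + 1)).eval ((x i : ℂ) + (r i.1 : ℂ))) ^ A i.1
    let c : ℕ ⊕ ℕ × ℕ → ℂ := fun a => ∑ w ∈ W with w i₀ = a,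
      (C w : ℂ) * ∏ i ∈ Finset.univ.erase i₀, pfFactor (r i) (w i) (x i)
    have hexp : ∀ z ∈ regularPoints, MvPolynomial.eval₂ K.subtype
        (Function.update (fun i => (x i : ℂ)) i₀ z) P /
          (ascPochhammer ℂ (n 0 + 1)).eval (z + r 0) ^ A 0 * z * D⁻¹ =
        (∑ a ∈ W.image (· i₀), c a * pfFactor (r 0) a z) * z := by
      intro z hz
      have h := hC (Function.update (fun i => (x i : ℂ)) i₀ z) fun i => by
        refine ascPochhammer_eval_ne_zero_of_mem_regularPoints ?_ _ _
        by_cases hi : i = i₀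
        · subst hi
          simpa using hz
        · simp [Function.update_of_ne hi]
      have hprod : ∀ F : Fin p → ℂ → ℂ,
          ∏ i, F i (Function.update (fun i => (x i : ℂ)) i₀ z i) =
            F i₀ z * ∏ i ∈ Finset.univ.erase i₀, F i (x i) := by
        intro F
        rw [← Finset.mul_prod_erase Finset.univ _ (Finset.mem_univ i₀), Function.update_self]
        congr 1
        exact Finset.prod_congr rfl fun k hk => by
          rw [Function.update_of_ne (Finset.ne_of_mem_erase hk)]
      rw [hprod fun i t => (ascPochhammer ℂ (n i.1 + 1)).eval (t + (r i.1 : ℂ)) ^ A i.1,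
        finsum_eq_sum_of_support_subset (s := W) _ ?_,
        ← Finset.sum_fiberwise_of_maps_to
          (fun w hw => Finset.mem_image_of_mem (· i₀) hw)] at h
      · have h' : ∑ a ∈ W.image (· i₀), c a * pfFactor (r 0) a z =
            MvPolynomial.eval₂ K.subtype (Function.update (fun i => (x i : ℂ)) i₀ z) P /
              ((ascPochhammer ℂ (n 0 + 1)).eval (z + r 0) ^ A 0 * D) := by
          refine Eq.trans ?_ h.symm
          refine Finset.sum_congr rfl fun a _ => ?_
          simp only [c, Finset.sum_mul]
          refine Finset.sum_congr rfl fun w hw => ?_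
          have hterm := hprod fun (i : Fin p) t => pfFactor (r i) (w i) t
          rw [(Finset.mem_filter.mp hw).2] at hterm
          change _ = (C w : ℂ) * ∏ i : Fin p, pfFactor (r i) (w i) _
          rw [hterm]
          ring
        rw [h', div_mul_eq_div_div]
        ring
      · intro w hw
        have : C w ≠ 0 := fun h0 => hw (by simp [h0])
        simpa [W] using this
    have hlim := ((tendsto_eval₂_update_div_ascPochhammer K P i₀ (A 0) (n 0) (r 0) hdeg
      (fun i => (x i : ℂ))).mul_const D⁻¹).mono_left
        (tendsto_natCast_atTop_cobounded (α := ℂ))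
    rw [zero_mul] at hlim
    have hres := sum_residues_eq_zero_of_tendsto (l := map (fun N : ℕ => (N : ℂ)) atTop)
      tendsto_natCast_atTop_cobounded (r 0) (W.image (· i₀)) (by
        intro a ha
        obtain ⟨w, hw, rfl⟩ := Finset.mem_image.mp (Finset.mem_coe.mp ha)
        exact hWV w hw i₀) c (hlim.congr' (by
        filter_upwards [eventually_regularPoints_map_natCast] with z hz
        exact hexp z hz))
    rw [← hres, ← Finset.sum_fiberwise_of_maps_to (g := (· i₀))
      (t := (W.image (· i₀)).filter fun a => ∃ j, a = Sum.inr (1, j))]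
    · refine Finset.sum_congr rfl fun a ha => ?_
      rw [Finset.filter_filter]
      refine Finset.sum_congr (Finset.filter_congr fun w _ => ?_) fun _ _ => rfl
      obtain ⟨j, hj⟩ := (Finset.mem_filter.mp ha).2
      exact ⟨fun h => h.2, fun h => ⟨⟨j, h.trans hj⟩, h⟩⟩
    · intro w hw
      rw [Finset.mem_filter] at hw ⊢
      exact ⟨Finset.mem_image_of_mem _ hw.1, hw.2⟩
  have hmain := sum_filter_eq_zero_of_linearIndepOn
    (fun (i : Fin p) a (z : regularPoints) => pfFactor (r i) a z) pfIndices
    (Finset.univ.erase i₀) (fun i _ => linearIndepOn_pfFactor (r i)) (fun w => (C w : ℂ))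
    (fun i => Sum.inr (s i, j i)) _
    (fun w hw i _ => hWV w (Finset.mem_filter.mp hw).1 i) hsep
  let v : ℕ → Fin p → ℕ ⊕ ℕ × ℕ :=
    fun j1 i => Sum.inr (if i.1 = 0 then (1, j1) else (s i, j i))
  have hv : Function.Injective v := fun a b h => by
    simpa [v, i₀] using congrFun h i₀
  suffices h : ∑ j1 ∈ Finset.Iic (n 0), ((C (v j1) : K) : ℂ) = 0 by
    apply Subtype.ext
    push_cast
    exact h
  rw [← hmain, ← Finset.sum_image (f := fun w => (C w : ℂ)) hv.injOn]
  symm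
  refine Finset.sum_subset (fun w hw => ?_) fun w hw hw' => ?_
  · simp only [Finset.mem_filter, Finset.mem_erase, Finset.mem_univ, and_true] at hw
    obtain ⟨⟨hwW, j1, hj1⟩, hwi⟩ := hw
    refine Finset.mem_image.mpr ⟨j1, Finset.mem_Iic.mpr ?_, ?_⟩
    · exact (hCrange w (by simpa [W] using hwW) i₀ 1 j1 hj1).2
    · funext i
      by_cases hi : i = i₀
      · subst hi
        simp [v, i₀, hj1]
      · simp [v, (hval i).not.mpr hi, hwi i hi]
  · obtain ⟨j1, _, rfl⟩ := Finset.mem_image.mp hw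
    by_contra hne
    refine hw' ?_
    simp only [Finset.mem_filter, Finset.mem_erase, Finset.mem_univ, and_true]
    refine ⟨⟨by simpa [W] using hne, j1, by simp [v, i₀]⟩, fun i hi => ?_⟩
    simp [v, (hval i).not.mpr hi]
end

section
/- Let A ≥ 2, n ≥ 0 and ℓ ≥ 1 be integers and let P ∈ ℚ[k] be a polynomial with deg P ≤ A(n+1) − 1. Set R(k) = P(k)/((k)_{n+1})^A. Then the series Σ_{k ≥ 1} R^{(ℓ)}(k) (where R^{(ℓ)} denotes the ℓ-th derivative of R) converges and is a ℚ-linear combination of 1, ζ(1+ℓ), ζ(2+ℓ), …, ζ(A+ℓ). -/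
/-- The value `ζ(s) = ∑_{k ≥ 1} 1/k^s` of the Riemann zeta function. -/
noncomputable def zv (s : ℕ) : ℝ := ∑' k : ℕ+, ((k : ℝ) ^ s)⁻¹

open Polynomial in
/-- Partial fractions with trivial polynomial part, in cleared form: a polynomial of degree less
than `A * #s` is decomposed with respect to `∏ i ∈ s, (X - a i) ^ A`. -/
theorem Polynomial.exists_eq_sum_C_mul_pow_mul_prod_erase {K ι : Type*} [Field K] [DecidableEq ι]
    (s : Finset ι) {a : ι → K} (ha : Function.Injective a) (A : ℕ) {f : K[X]}
    (hf : f.degree < ((A * s.card : ℕ) : WithBot ℕ)) :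
    ∃ c : ι → Fin A → K, f = ∑ i ∈ s, ∑ j : Fin A,
      C (c i j) * (X - C (a i)) ^ (j : ℕ) * ∏ k ∈ s.erase i, (X - C (a k)) ^ A := by
  obtain ⟨q, r, hr, h⟩ := eq_quo_mul_prod_pow_add_sum_rem_mul_prod_pow (s := s) f
    (g := fun i => X - C (a i)) (fun i _ => monic_X_sub_C _)
    (fun i _ j _ hij => isCoprime_X_sub_C_of_isUnit_sub
      (sub_ne_zero.2 (ha.ne hij)).isUnit) (fun _ => A)
  have hrC : ∀ i ∈ s, ∀ j, r i j = C ((r i j).coeff 0) := fun i hi j =>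
    eq_C_of_degree_le_zero (by simpa [Nat.WithBot.lt_one_iff_le_zero] using hr i hi j)
  have hD : (∏ i ∈ s, (X - C (a i)) ^ A).Monic :=
    monic_prod_of_monic _ _ fun i _ => (monic_X_sub_C _).pow A
  have hDdeg : (∏ i ∈ s, (X - C (a i)) ^ A).degree = ((A * s.card : ℕ) : WithBot ℕ) := by
    simp [degree_prod, mul_comm]
  have hlt : (∑ i ∈ s, ∑ j, r i j * (X - C (a i)) ^ (j : ℕ) *
      ∏ k ∈ s.erase i, (X - C (a k)) ^ A).degree < ((A * s.card : ℕ) : WithBot ℕ) := by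
    rw [← mem_degreeLT]
    refine Submodule.sum_mem _ fun i hi => Submodule.sum_mem _ fun j _ => ?_
    rw [mem_degreeLT, hrC i hi j, mul_assoc, ← smul_eq_C_mul]
    refine (degree_smul_le _ _).trans_lt ?_
    have hcard : A * s.card = A + A * (s.erase i).card := by
      rw [← Finset.card_erase_add_one hi]; ring
    rw [degree_mul, degree_prod, hcard]
    simp only [degree_pow, degree_X_sub_C, Finset.sum_const, nsmul_eq_mul, mul_one]
    rw [mul_comm A]
    exact_mod_cast Nat.add_lt_add_right j.2 _
  have hq : q = 0 := by
    rw [← (div_modByMonic_unique (f := f) q _ hD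
        ⟨by rw [add_comm, mul_comm]; exact h.symm, by rwa [hDdeg]⟩).1,
      divByMonic_eq_zero_iff hD, hDdeg]
    exact hf
  refine ⟨fun i j => (r i j).coeff 0, ?_⟩
  rw [hq, zero_mul, zero_add] at h
  refine h.trans (Finset.sum_congr rfl fun i hi => Finset.sum_congr rfl fun j _ => ?_)
  rw [← hrC i hi j]

open Polynomial in
theorem ascPochhammer_eval_eq_prod_range {R : Type*} [CommSemiring R] (n : ℕ) (x : R) :
    (ascPochhammer R n).eval x = ∏ i ∈ Finset.range n, (x + i) := by
  induction n with
  | zero => simp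
  | succ n ih => rw [ascPochhammer_succ_eval, ih, Finset.prod_range_succ]

open Polynomial in
/-- Partial fraction decomposition of `P / (k)_n ^ A` away from the poles. -/
theorem exists_aeval_div_ascPochhammer_pow_eq_sum (A n : ℕ) {P : ℚ[X]}
    (hP : P.degree < ((A * n : ℕ) : WithBot ℕ)) :
    ∃ c : ℕ → Fin A → ℚ, ∀ x : ℝ, 0 < x →
      aeval x P / (ascPochhammer ℝ n).eval x ^ A =
        ∑ i ∈ Finset.range n, ∑ j : Fin A, (c i j : ℝ) * ((x + i) ^ (A - j : ℕ))⁻¹ := by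
  obtain ⟨c, hc⟩ := exists_eq_sum_C_mul_pow_mul_prod_erase (Finset.range n)
    (a := fun i : ℕ => -(i : ℚ)) (fun i j h => by simpa using h) A (f := P) (by simpa using hP)
  refine ⟨c, fun x hx => ?_⟩
  have hne : ∀ i : ℕ, x + i ≠ 0 := fun i => by positivity
  rw [ascPochhammer_eval_eq_prod_range, ← Finset.prod_pow]
  conv_lhs => rw [hc]
  simp only [map_sum, Finset.sum_div]
  refine Finset.sum_congr rfl fun i hi => Finset.sum_congr rfl fun j _ => ?_
  rw [← Finset.mul_prod_erase _ _ hi]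
  have hprod : ∏ k ∈ (Finset.range n).erase i, (x + k) ^ A ≠ 0 :=
    Finset.prod_ne_zero_iff.2 fun k _ => pow_ne_zero _ (hne k)
  have hpow : (x + i) ^ A = (x + i) ^ (j : ℕ) * (x + i) ^ (A - j : ℕ) := by
    rw [← pow_add, Nat.add_sub_cancel' j.2.le]
  simp only [map_mul, map_pow, map_sub, map_prod, aeval_X, aeval_C, eq_ratCast, Rat.cast_neg,
    Rat.cast_natCast, sub_neg_eq_add, hpow]
  have := hne i
  field_simp

theorem iteratedDeriv_inv_add_pow (l m : ℕ) (b x : ℝ) :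
    iteratedDeriv l (fun y : ℝ => ((y + b) ^ m)⁻¹) x =
      (∏ i ∈ Finset.range l, (-(m : ℝ) - i)) * ((x + b) ^ (m + l))⁻¹ := by
  have h : (fun y : ℝ => (y ^ m)⁻¹) = fun y => y ^ (-(m : ℤ)) := by
    ext y; rw [zpow_neg, zpow_natCast]
  rw [iteratedDeriv_comp_add_const l (fun y : ℝ => (y ^ m)⁻¹), h, iteratedDeriv_eq_iterate]
  simp only [iter_deriv_zpow]
  rw [← neg_add', ← Nat.cast_add, zpow_neg, zpow_natCast]
  push_cast
  rfl

theorem hasSum_pnat_inv_add_pow (i : ℕ) {s : ℕ} (hs : 2 ≤ s) :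
    HasSum (fun k : ℕ+ => (((k : ℝ) + i) ^ s)⁻¹)
      (zv s - ∑ m ∈ Finset.range i, (((m : ℝ) + 1) ^ s)⁻¹) := by
  have hsum : Summable fun m : ℕ => (((m : ℝ) + 1) ^ s)⁻¹ := by
    simpa using (summable_nat_add_iff 1).2 (Real.summable_nat_pow_inv.2 hs)
  have hzv : zv s = ∑' m : ℕ, (((m : ℝ) + 1) ^ s)⁻¹ := by
    rw [zv, tsum_pnat_eq_tsum_succ (f := fun k : ℕ => ((k : ℝ) ^ s)⁻¹)]
    simp
  rw [← Equiv.pnatEquivNat.symm.hasSum_iff, hzv]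
  have hcomp : (fun k : ℕ+ => (((k : ℝ) + i) ^ s)⁻¹) ∘ Equiv.pnatEquivNat.symm =
      fun m : ℕ => (((m + i : ℕ) + 1 : ℝ) ^ s)⁻¹ := by
    ext m
    simp [add_right_comm]
  rw [hcomp]
  exact (hasSum_nat_add_iff' i).2 hsum.hasSum

theorem statement7 (A n l : ℕ) (hA : 2 ≤ A) (hl : 1 ≤ l) (P : Polynomial ℚ)
    (hdeg : P.natDegree + 1 ≤ A * (n + 1)) :
    Summable (fun k : ℕ+ => iteratedDeriv l
        (fun x : ℝ => (Polynomial.aeval x) P / ((ascPochhammer ℝ (n + 1)).eval x) ^ A)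
        (k : ℝ)) ∧
    ∃ (c₀ : ℚ) (c : ℕ → ℚ),
      (∑' k : ℕ+, iteratedDeriv l
          (fun x : ℝ => (Polynomial.aeval x) P / ((ascPochhammer ℝ (n + 1)).eval x) ^ A)
          (k : ℝ))
        = c₀ + ∑ s ∈ Finset.Icc (1 + l) (A + l), (c s : ℝ) * zv s := by
  obtain ⟨c, hc⟩ := exists_aeval_div_ascPochhammer_pow_eq_sum A (n + 1) (P := P)
    (Polynomial.degree_le_natDegree.trans_lt (by exact_mod_cast hdeg))
  have hderiv : ∀ x : ℝ, 0 < x → iteratedDeriv l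
      (fun x : ℝ => (Polynomial.aeval x) P / ((ascPochhammer ℝ (n + 1)).eval x) ^ A) x =
      ∑ i ∈ Finset.range (n + 1), ∑ j : Fin A,
        ((c i j * ∏ t ∈ Finset.range l, (-((A - j : ℕ) : ℚ) - t) : ℚ) : ℝ) *
          ((x + i) ^ ((A - j : ℕ) + l))⁻¹ := by
    intro x hx
    have hev := (eventually_gt_nhds hx).mono hc
    have hsmooth : ∀ (i : ℕ) (j : Fin A), ContDiffAt ℝ l
        (fun y : ℝ => (c i j : ℝ) * ((y + i) ^ (A - j : ℕ))⁻¹) x := fun i j =>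
      contDiffAt_const.mul (((contDiffAt_id.add contDiffAt_const).pow _).inv
        (pow_ne_zero _ (by simp only [id]; positivity)))
    rw [Filter.EventuallyEq.iteratedDeriv_eq l hev, iteratedDeriv_fun_sum
      fun i _ => ContDiffAt.sum fun j _ => hsmooth i j]
    refine Finset.sum_congr rfl fun i _ => ?_
    rw [iteratedDeriv_fun_sum fun j _ => hsmooth i j]
    refine Finset.sum_congr rfl fun j _ => ?_
    rw [iteratedDeriv_const_mul_field, iteratedDeriv_inv_add_pow]
    push_cast
    ring
  have hsum : HasSum (fun k : ℕ+ => iteratedDeriv l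
      (fun x : ℝ => (Polynomial.aeval x) P / ((ascPochhammer ℝ (n + 1)).eval x) ^ A) (k : ℝ))
      (∑ i ∈ Finset.range (n + 1), ∑ j : Fin A,
        ((c i j * ∏ t ∈ Finset.range l, (-((A - j : ℕ) : ℚ) - t) : ℚ) : ℝ) *
          (zv ((A - j : ℕ) + l) -
            ∑ m ∈ Finset.range i, (((m : ℝ) + 1) ^ ((A - j : ℕ) + l))⁻¹)) := by
    simp only [fun k : ℕ+ => hderiv k (by exact_mod_cast k.pos)]
    exact hasSum_sum fun i _ => hasSum_sum fun j _ =>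
      (hasSum_pnat_inv_add_pow i (by have := j.2; omega)).mul_left _
  refine ⟨hsum.summable, ?_⟩
  rw [hsum.tsum_eq]
  generalize hv : (∑ i ∈ Finset.range (n + 1), _ : ℝ) = v
  have hmem : v ∈ Submodule.span ℚ (insert 1 (zv '' (Finset.Icc (1 + l) (A + l) : Set ℕ))) := by
    rw [← hv]
    refine Submodule.sum_mem _ fun i _ => Submodule.sum_mem _ fun j _ => ?_
    rw [← Rat.smul_def]
    refine Submodule.smul_mem _ _ (Submodule.sub_mem _ (Submodule.subset_span <|
      Set.mem_insert_of_mem _ <| Set.mem_image_of_mem _ ?_) ?_)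
    · have := j.2
      simp only [Finset.coe_Icc, Set.mem_Icc]
      omega
    · convert Submodule.smul_mem _ (∑ m ∈ Finset.range i, (((m : ℚ) + 1) ^ ((A - j : ℕ) + l))⁻¹)
        (Submodule.subset_span (Set.mem_insert (1 : ℝ) _)) using 1
      simp [Rat.smul_def]
  obtain ⟨c₀, w, hw, rfl⟩ := Submodule.mem_span_insert.1 hmem
  obtain ⟨d, rfl⟩ := (Submodule.mem_span_image_finset_iff_exists_fun' ℚ).1 hw
  exact ⟨c₀, d, by simp [Rat.smul_def]⟩
end
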